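/- arXiv:1309.5250 — 2 statements merged into one kernel-verified Lean document; each statement's English description precedes it below -/
import Mathlib

section
/- Suppose M, N > 1. In the superalgebra V, [O^±, X^∓_{i,0}] = 0 for all 1 ≤ i ≤ M+N−1 (the graded commutator of every element of O^± with every X^∓_{i,0} vanishes). Consequently V⁻O⁻V⁻V⁰V⁺ and V⁻V⁰V⁺O⁺V⁺ are two-sided ideals of V. -/
noncomputable section

namespace QAS

open Polynomial
open scoped TensorProduct

/-! ### Basic combinatorial data -/

/-- `l_i = 1` for `i ≤ M`, `-1` otherwise. -/
def lof (M : ℕ) (i : ℕ) : ℤ := if i ≤ M then 1 else -1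

/-- the bilinear form `(ε_i, ε_j) = l_i δ_{ij}`. -/
def innerE (M : ℕ) (i j : ℕ) : ℤ := if i = j then lof M i else 0

/-- `(ε_a − ε_b, ε_c − ε_d)`. -/
def form4 (M : ℕ) (a b c d : ℕ) : ℤ :=
  innerE M a c - innerE M a d - innerE M b c + innerE M b d

/-- the Cartan pairing `c_{ij} = (ε_i − ε_{i+1}, ε_j − ε_{j+1})`. -/
def cc (M : ℕ) (i j : ℕ) : ℤ := form4 M i (i + 1) j (j + 1)

/-- `q_i = q^{l_i}`. -/
def qpar (q : ℂ) (M : ℕ) (i : ℕ) : ℂ := q ^ lof M i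

/-- the quantum integer `[m]_v`. -/
def qint (v : ℂ) (m : ℤ) : ℂ := (v ^ m - v ^ (-m)) / (v - v⁻¹)

/-- the sign `(−1)^{|X_i||X_j|}` for the generators `X_i`, `X_j`. -/
def sgn (M : ℕ) (i j : ℕ) : ℂ := if i = M ∧ j = M then -1 else 1

/-- index set `1 ≤ i ≤ M+N−1`. -/
abbrev Idx (M N : ℕ) := {i : ℕ // 1 ≤ i ∧ i ≤ M + N - 1}

/-! ### Generators and the free superalgebra -/

/-- Drinfel'd generators; when `ext = true` we also have `K₀^{±1}`. -/
inductive Gen (M N : ℕ) (ext : Bool) : Type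
  | Xp : Idx M N → ℤ → Gen M N ext
  | Xm : Idx M N → ℤ → Gen M N ext
  | K : Idx M N → Gen M N ext
  | Ki : Idx M N → Gen M N ext
  | H : Idx M N → {s : ℤ // s ≠ 0} → Gen M N ext
  | K0 : ext = true → Gen M N ext
  | K0i : ext = true → Gen M N ext

abbrev FA (M N : ℕ) (ext : Bool) := FreeAlgebra ℂ (Gen M N ext)

def gi {M N : ℕ} {ext : Bool} (g : Gen M N ext) : FA M N ext := FreeAlgebra.ι ℂ g

def XpF (M N : ℕ) (ext : Bool) (i : ℕ) (n : ℤ) : FA M N ext :=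
  if h : 1 ≤ i ∧ i ≤ M + N - 1 then gi (Gen.Xp ⟨i, h⟩ n) else 0

def XmF (M N : ℕ) (ext : Bool) (i : ℕ) (n : ℤ) : FA M N ext :=
  if h : 1 ≤ i ∧ i ≤ M + N - 1 then gi (Gen.Xm ⟨i, h⟩ n) else 0

def KF (M N : ℕ) (ext : Bool) (i : ℕ) : FA M N ext :=
  if h : 1 ≤ i ∧ i ≤ M + N - 1 then gi (Gen.K ⟨i, h⟩) else 0

def KiF (M N : ℕ) (ext : Bool) (i : ℕ) : FA M N ext :=
  if h : 1 ≤ i ∧ i ≤ M + N - 1 then gi (Gen.Ki ⟨i, h⟩) else 0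

def HF (M N : ℕ) (ext : Bool) (i : ℕ) (s : ℤ) : FA M N ext :=
  if h : (1 ≤ i ∧ i ≤ M + N - 1) ∧ s ≠ 0 then gi (Gen.H ⟨i, h.1⟩ ⟨s, h.2⟩) else 0

def K0F (M N : ℕ) (ext : Bool) : FA M N ext :=
  if h : ext = true then gi (Gen.K0 h) else 0

def K0iF (M N : ℕ) (ext : Bool) : FA M N ext :=
  if h : ext = true then gi (Gen.K0i h) else 0

/-- coefficients of `exp (t · Σ_{s ≥ 1} a_s z^s)`. -/
def expC {A : Type} [Ring A] [Algebra ℂ A] (t : ℂ) (a : ℕ → A) : ℕ → A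
  | 0 => 1
  | n + 1 =>
      ((n : ℂ) + 1)⁻¹ •
        (t • ∑ s ∈ Finset.range (n + 1), ((s : ℂ) + 1) • (a (s + 1) * expC t a (n - s)))
termination_by n => n
decreasing_by omega

/-- `φ⁺_{i,n}`, the coefficient of `z^n` in
`K_i exp((q_i − q_i⁻¹) Σ_{s>0} h_{i,s} z^s)`. -/
def phiPF (q : ℂ) (M N : ℕ) (ext : Bool) (i : ℕ) (n : ℤ) : FA M N ext :=
  if 0 ≤ n then
    KF M N ext i *
      expC (qpar q M i - (qpar q M i)⁻¹) (fun s => HF M N ext i (s : ℤ)) n.toNat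
  else 0

/-- `φ⁻_{i,n}`, the coefficient of `z^n` (`n ≤ 0`) in
`K_i⁻¹ exp(−(q_i − q_i⁻¹) Σ_{s>0} h_{i,−s} z^{−s})`. -/
def phiMF (q : ℂ) (M N : ℕ) (ext : Bool) (i : ℕ) (n : ℤ) : FA M N ext :=
  if n ≤ 0 then
    KiF M N ext i *
      expC (-(qpar q M i - (qpar q M i)⁻¹)) (fun s => HF M N ext i (-(s : ℤ))) (-n).toNat
  else 0

/-- the `u`-bracket `[x,y]_u = xy − u·yx` (for `x` or `y` of even parity). -/
def brF {A : Type} [Ring A] [Module ℂ A] (u : ℂ) (x y : A) : A := x * y - u • (y * x)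

/-- the quartic oscillation expression
`[[[X_{M−1,m}, X_{M,n}]_{q⁻¹}, X_{M+1,k}]_q, X_{M,u}]` (a graded anticommutator in the
outermost bracket, both entries being odd). -/
def oscOf {A : Type} [Ring A] [Module ℂ A] (q : ℂ) (M : ℕ) (X : ℕ → ℤ → A) (m n k u : ℤ) : A :=
  brF q (brF q⁻¹ (X (M - 1) m) (X M n)) (X (M + 1) k) * X M u +
    X M u * brF q (brF q⁻¹ (X (M - 1) m) (X M n)) (X (M + 1) k)

/-! ### The defining relations.
`lvl = 1`: only (R1)–(R3);  `lvl = 2`: (R1)–(R5);  `lvl = 3`: all of (R1)–(R7).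
`ext = true` adds `K₀^{±1}` together with its relations. -/

inductive rel (q : ℂ) (M N : ℕ) (ext : Bool) (lvl : ℕ) : FA M N ext → FA M N ext → Prop
  | KKi (i : Idx M N) : rel q M N ext lvl (gi (Gen.K i) * gi (Gen.Ki i)) 1
  | KiK (i : Idx M N) : rel q M N ext lvl (gi (Gen.Ki i) * gi (Gen.K i)) 1
  | KK (i j : Idx M N) :
      rel q M N ext lvl (gi (Gen.K i) * gi (Gen.K j)) (gi (Gen.K j) * gi (Gen.K i))
  | KKi2 (i j : Idx M N) :
      rel q M N ext lvl (gi (Gen.K i) * gi (Gen.Ki j)) (gi (Gen.Ki j) * gi (Gen.K i))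
  | KiKi (i j : Idx M N) :
      rel q M N ext lvl (gi (Gen.Ki i) * gi (Gen.Ki j)) (gi (Gen.Ki j) * gi (Gen.Ki i))
  | KH (i j : Idx M N) (s : {s : ℤ // s ≠ 0}) :
      rel q M N ext lvl (gi (Gen.K i) * gi (Gen.H j s)) (gi (Gen.H j s) * gi (Gen.K i))
  | KiH (i j : Idx M N) (s : {s : ℤ // s ≠ 0}) :
      rel q M N ext lvl (gi (Gen.Ki i) * gi (Gen.H j s)) (gi (Gen.H j s) * gi (Gen.Ki i))
  | HH (i j : Idx M N) (s t : {s : ℤ // s ≠ 0}) :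
      rel q M N ext lvl (gi (Gen.H i s) * gi (Gen.H j t)) (gi (Gen.H j t) * gi (Gen.H i s))
  | KXp (i j : Idx M N) (n : ℤ) :
      rel q M N ext lvl (gi (Gen.K i) * gi (Gen.Xp j n))
        ((q ^ cc M i.1 j.1) • (gi (Gen.Xp j n) * gi (Gen.K i)))
  | KXm (i j : Idx M N) (n : ℤ) :
      rel q M N ext lvl (gi (Gen.K i) * gi (Gen.Xm j n))
        ((q ^ (-cc M i.1 j.1)) • (gi (Gen.Xm j n) * gi (Gen.K i)))
  | HXp (i j : Idx M N) (s : {s : ℤ // s ≠ 0}) (n : ℤ) :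
      rel q M N ext lvl
        (gi (Gen.H i s) * gi (Gen.Xp j n) - gi (Gen.Xp j n) * gi (Gen.H i s))
        ((qint (qpar q M i.1) (s.1 * lof M i.1 * cc M i.1 j.1) / (s.1 : ℂ)) •
          gi (Gen.Xp j (n + s.1)))
  | HXm (i j : Idx M N) (s : {s : ℤ // s ≠ 0}) (n : ℤ) :
      rel q M N ext lvl
        (gi (Gen.H i s) * gi (Gen.Xm j n) - gi (Gen.Xm j n) * gi (Gen.H i s))
        (-((qint (qpar q M i.1) (s.1 * lof M i.1 * cc M i.1 j.1) / (s.1 : ℂ)) •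
          gi (Gen.Xm j (n + s.1))))
  | XpXm (i j : Idx M N) (m n : ℤ) :
      rel q M N ext lvl
        (gi (Gen.Xp i m) * gi (Gen.Xm j n) -
          sgn M i.1 j.1 • (gi (Gen.Xm j n) * gi (Gen.Xp i m)))
        (if i = j then
            (qpar q M i.1 - (qpar q M i.1)⁻¹)⁻¹ •
              (phiPF q M N ext i.1 (m + n) - phiMF q M N ext i.1 (m + n))
          else 0)
  | XX0p (i j : Idx M N) (m n : ℤ) (h2 : 2 ≤ lvl) (h : cc M i.1 j.1 = 0) :
      rel q M N ext lvl
        (gi (Gen.Xp i m) * gi (Gen.Xp j n) -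
          sgn M i.1 j.1 • (gi (Gen.Xp j n) * gi (Gen.Xp i m))) 0
  | XX0m (i j : Idx M N) (m n : ℤ) (h2 : 2 ≤ lvl) (h : cc M i.1 j.1 = 0) :
      rel q M N ext lvl
        (gi (Gen.Xm i m) * gi (Gen.Xm j n) -
          sgn M i.1 j.1 • (gi (Gen.Xm j n) * gi (Gen.Xm i m))) 0
  | XXp (i j : Idx M N) (m n : ℤ) (h2 : 2 ≤ lvl) (h : cc M i.1 j.1 ≠ 0) :
      rel q M N ext lvl
        (gi (Gen.Xp i (m + 1)) * gi (Gen.Xp j n) -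
          (q ^ cc M i.1 j.1) • (gi (Gen.Xp j n) * gi (Gen.Xp i (m + 1))))
        ((q ^ cc M i.1 j.1) • (gi (Gen.Xp i m) * gi (Gen.Xp j (n + 1))) -
          gi (Gen.Xp j (n + 1)) * gi (Gen.Xp i m))
  | XXm (i j : Idx M N) (m n : ℤ) (h2 : 2 ≤ lvl) (h : cc M i.1 j.1 ≠ 0) :
      rel q M N ext lvl
        (gi (Gen.Xm i (m + 1)) * gi (Gen.Xm j n) -
          (q ^ (-cc M i.1 j.1)) • (gi (Gen.Xm j n) * gi (Gen.Xm i (m + 1))))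
        ((q ^ (-cc M i.1 j.1)) • (gi (Gen.Xm i m) * gi (Gen.Xm j (n + 1))) -
          gi (Gen.Xm j (n + 1)) * gi (Gen.Xm i m))
  | serreP (i j : Idx M N) (m n k : ℤ) (h3 : 3 ≤ lvl)
      (h : cc M i.1 j.1 = 1 ∨ cc M i.1 j.1 = -1) (hi : i.1 ≠ M) :
      rel q M N ext lvl
        (brF q (gi (Gen.Xp i m)) (brF q⁻¹ (gi (Gen.Xp i n)) (gi (Gen.Xp j k))) +
          brF q (gi (Gen.Xp i n)) (brF q⁻¹ (gi (Gen.Xp i m)) (gi (Gen.Xp j k)))) 0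
  | serreM (i j : Idx M N) (m n k : ℤ) (h3 : 3 ≤ lvl)
      (h : cc M i.1 j.1 = 1 ∨ cc M i.1 j.1 = -1) (hi : i.1 ≠ M) :
      rel q M N ext lvl
        (brF q (gi (Gen.Xm i m)) (brF q⁻¹ (gi (Gen.Xm i n)) (gi (Gen.Xm j k))) +
          brF q (gi (Gen.Xm i n)) (brF q⁻¹ (gi (Gen.Xm i m)) (gi (Gen.Xm j k)))) 0
  | oscP (m n k u : ℤ) (h3 : 3 ≤ lvl) (hM : 1 < M) (hN : 1 < N) :
      rel q M N ext lvl
        (oscOf q M (XpF M N ext) m n k u + oscOf q M (XpF M N ext) m u k n) 0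
  | oscM (m n k u : ℤ) (h3 : 3 ≤ lvl) (hM : 1 < M) (hN : 1 < N) :
      rel q M N ext lvl
        (oscOf q M (XmF M N ext) m n k u + oscOf q M (XmF M N ext) m u k n) 0
  | K0K0i (he : ext = true) : rel q M N ext lvl (gi (Gen.K0 he) * gi (Gen.K0i he)) 1
  | K0iK0 (he : ext = true) : rel q M N ext lvl (gi (Gen.K0i he) * gi (Gen.K0 he)) 1
  | K0K (he : ext = true) (i : Idx M N) :
      rel q M N ext lvl (gi (Gen.K0 he) * gi (Gen.K i)) (gi (Gen.K i) * gi (Gen.K0 he))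
  | K0Ki (he : ext = true) (i : Idx M N) :
      rel q M N ext lvl (gi (Gen.K0 he) * gi (Gen.Ki i)) (gi (Gen.Ki i) * gi (Gen.K0 he))
  | K0H (he : ext = true) (i : Idx M N) (s : {s : ℤ // s ≠ 0}) :
      rel q M N ext lvl (gi (Gen.K0 he) * gi (Gen.H i s)) (gi (Gen.H i s) * gi (Gen.K0 he))
  | K0Xp (he : ext = true) (i : Idx M N) (n : ℤ) :
      rel q M N ext lvl (gi (Gen.K0 he) * gi (Gen.Xp i n))
        ((q ^ (if i.1 = 1 then (1 : ℤ) else 0)) • (gi (Gen.Xp i n) * gi (Gen.K0 he)))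
  | K0Xm (he : ext = true) (i : Idx M N) (n : ℤ) :
      rel q M N ext lvl (gi (Gen.K0 he) * gi (Gen.Xm i n))
        ((q ^ (if i.1 = 1 then (-1 : ℤ) else 0)) • (gi (Gen.Xm i n) * gi (Gen.K0 he)))

/-! ### The quantum affine superalgebras -/

abbrev ALG (q : ℂ) (M N : ℕ) (ext : Bool) (lvl : ℕ) := RingQuot (rel q M N ext lvl)

def mkA (q : ℂ) (M N : ℕ) (ext : Bool) (lvl : ℕ) : FA M N ext →ₐ[ℂ] ALG q M N ext lvl :=
  RingQuot.mkAlgHom ℂ (rel q M N ext lvl)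

def XpA (q : ℂ) (M N : ℕ) (ext : Bool) (lvl : ℕ) (i : ℕ) (n : ℤ) : ALG q M N ext lvl :=
  mkA q M N ext lvl (XpF M N ext i n)

def XmA (q : ℂ) (M N : ℕ) (ext : Bool) (lvl : ℕ) (i : ℕ) (n : ℤ) : ALG q M N ext lvl :=
  mkA q M N ext lvl (XmF M N ext i n)

def KA (q : ℂ) (M N : ℕ) (ext : Bool) (lvl : ℕ) (i : ℕ) : ALG q M N ext lvl :=
  mkA q M N ext lvl (KF M N ext i)

def KiA (q : ℂ) (M N : ℕ) (ext : Bool) (lvl : ℕ) (i : ℕ) : ALG q M N ext lvl :=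
  mkA q M N ext lvl (KiF M N ext i)

def HA (q : ℂ) (M N : ℕ) (ext : Bool) (lvl : ℕ) (i : ℕ) (s : ℤ) : ALG q M N ext lvl :=
  mkA q M N ext lvl (HF M N ext i s)

def K0A (q : ℂ) (M N : ℕ) (ext : Bool) (lvl : ℕ) : ALG q M N ext lvl :=
  mkA q M N ext lvl (K0F M N ext)

def K0iA (q : ℂ) (M N : ℕ) (ext : Bool) (lvl : ℕ) : ALG q M N ext lvl :=
  mkA q M N ext lvl (K0iF M N ext)

def phiPA (q : ℂ) (M N : ℕ) (ext : Bool) (lvl : ℕ) (i : ℕ) (n : ℤ) : ALG q M N ext lvl :=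
  mkA q M N ext lvl (phiPF q M N ext i n)

def phiMA (q : ℂ) (M N : ℕ) (ext : Bool) (lvl : ℕ) (i : ℕ) (n : ℤ) : ALG q M N ext lvl :=
  mkA q M N ext lvl (phiMF q M N ext i n)

/-- `U⁺`: the subalgebra generated by the `X⁺_{i,n}`. -/
def Aplus (q : ℂ) (M N : ℕ) (ext : Bool) (lvl : ℕ) : Subalgebra ℂ (ALG q M N ext lvl) :=
  Algebra.adjoin ℂ {x | ∃ i : ℕ, ∃ n : ℤ, x = XpA q M N ext lvl i n}

/-- `U⁻`: the subalgebra generated by the `X⁻_{i,n}`. -/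
def Aminus (q : ℂ) (M N : ℕ) (ext : Bool) (lvl : ℕ) : Subalgebra ℂ (ALG q M N ext lvl) :=
  Algebra.adjoin ℂ {x | ∃ i : ℕ, ∃ n : ℤ, x = XmA q M N ext lvl i n}

/-- `U⁰`: the subalgebra generated by the `K_i^{±1}` and `h_{i,s}`. -/
def Azero (q : ℂ) (M N : ℕ) (ext : Bool) (lvl : ℕ) : Subalgebra ℂ (ALG q M N ext lvl) :=
  Algebra.adjoin ℂ {x | (∃ i : ℕ, x = KA q M N ext lvl i) ∨ (∃ i : ℕ, x = KiA q M N ext lvl i) ∨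
    ∃ i : ℕ, ∃ s : ℤ, x = HA q M N ext lvl i s}

/-- `U'⁰`: the subalgebra generated by `U⁰` and `K₀^{±1}`. -/
def AzeroE (q : ℂ) (M N : ℕ) (ext : Bool) (lvl : ℕ) : Subalgebra ℂ (ALG q M N ext lvl) :=
  Algebra.adjoin ℂ {x | (∃ i : ℕ, x = KA q M N ext lvl i) ∨ (∃ i : ℕ, x = KiA q M N ext lvl i) ∨
    (∃ i : ℕ, ∃ s : ℤ, x = HA q M N ext lvl i s) ∨ x = K0A q M N ext lvl ∨
      x = K0iA q M N ext lvl}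

/-! ### The multiplication map on the triple tensor product -/

def triMul (q : ℂ) (M N : ℕ) (ext : Bool) (lvl : ℕ)
    (S T R : Subalgebra ℂ (ALG q M N ext lvl)) :
    (↥S ⊗[ℂ] (↥T ⊗[ℂ] ↥R)) →ₗ[ℂ] ALG q M N ext lvl :=
  TensorProduct.lift
    (((LinearMap.mul ℂ (ALG q M N ext lvl)).comp S.val.toLinearMap).compl₂
      (TensorProduct.lift
        (((LinearMap.mul ℂ (ALG q M N ext lvl)).comp T.val.toLinearMap).compl₂
          R.val.toLinearMap)))

/-! ### Root vectors and PBW monomials -/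

def Xroot (q : ℂ) (M N : ℕ) (ext : Bool) (lvl : ℕ) (i : ℕ) : ℕ → ℤ → ALG q M N ext lvl
  | 0, n => XpA q M N ext lvl i n
  | k + 1, n =>
      brF (qpar q M (i + k + 1)) (Xroot q M N ext lvl i k n) (XpA q M N ext lvl (i + k + 1) 0)

/-- the root vector `X_{α_i + ⋯ + α_j}(n)`. -/
def XrootIJ (q : ℂ) (M N : ℕ) (ext : Bool) (lvl : ℕ) (i j : ℕ) (n : ℤ) : ALG q M N ext lvl :=
  Xroot q M N ext lvl i (j - i) n

def rootLE (a b : ℕ × ℕ) : Prop := a.1 < b.1 ∨ (a.1 = b.1 ∧ a.2 ≤ b.2)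

/-- the set of PBW ordered monomials in the root vectors. -/
def pbwSet (q : ℂ) (M N : ℕ) (ext : Bool) (lvl : ℕ) : Set (ALG q M N ext lvl) :=
  {x | ∃ L : List ((ℕ × ℕ) × ℤ),
      (∀ p ∈ L, 1 ≤ p.1.1 ∧ p.1.1 ≤ p.1.2 ∧ p.1.2 ≤ M + N - 1) ∧
      L.Chain' (fun a b => rootLE a.1 b.1) ∧
      x = (L.map fun p => XrootIJ q M N ext lvl p.1.1 p.1.2 p.2).prod}

/-- PBW ordered monomials of total degree `d` (`d i` counts the multiplicity of `α_i`). -/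
def pbwDegSet (q : ℂ) (M N : ℕ) (ext : Bool) (lvl : ℕ) (d : ℕ → ℕ) : Set (ALG q M N ext lvl) :=
  {x | ∃ L : List ((ℕ × ℕ) × ℤ),
      (∀ p ∈ L, 1 ≤ p.1.1 ∧ p.1.1 ≤ p.1.2 ∧ p.1.2 ≤ M + N - 1) ∧
      L.Chain' (fun a b => rootLE a.1 b.1) ∧
      (∀ i : ℕ, ((L.map fun p => if p.1.1 ≤ i ∧ i ≤ p.1.2 then 1 else 0).sum) = d i) ∧
      x = (L.map fun p => XrootIJ q M N ext lvl p.1.1 p.1.2 p.2).prod}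

/-- words in the generators `X⁺_{i,n}` of degree `d`. -/
def wordDegSet (q : ℂ) (M N : ℕ) (ext : Bool) (lvl : ℕ) (d : ℕ → ℕ) :
    Set (ALG q M N ext lvl) :=
  {x | ∃ w : List (ℕ × ℤ), (∀ p ∈ w, 1 ≤ p.1 ∧ p.1 ≤ M + N - 1) ∧
      (∀ i : ℕ, (w.map Prod.fst).count i = d i) ∧
      x = (w.map fun p => XpA q M N ext lvl p.1 p.2).prod}

/-! ### The subspaces `I^±_{i,j}` and `O^±` -/

def IElt (q : ℂ) (M N : ℕ) (ext : Bool) (lvl : ℕ) (pl : Bool) (i j : ℕ) (m n : ℤ) :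
    ALG q M N ext lvl :=
  let X : ℕ → ℤ → ALG q M N ext lvl := if pl then XpA q M N ext lvl else XmA q M N ext lvl
  let e : ℤ := if pl then cc M i j else -cc M i j
  if cc M i j = 0 then X i m * X j n - sgn M i j • (X j n * X i m)
  else
    X i (m + 1) * X j n - (q ^ e) • (X j n * X i (m + 1)) -
      (q ^ e) • (X i m * X j (n + 1)) + X j (n + 1) * X i m

def Isub (q : ℂ) (M N : ℕ) (ext : Bool) (lvl : ℕ) (pl : Bool) (i j : ℕ) :
    Submodule ℂ (ALG q M N ext lvl) :=
  Submodule.span ℂ (Set.range fun p : ℤ × ℤ => IElt q M N ext lvl pl i j p.1 p.2)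

def IsubAll (q : ℂ) (M N : ℕ) (ext : Bool) (lvl : ℕ) (pl : Bool) :
    Submodule ℂ (ALG q M N ext lvl) :=
  ⨆ p : ℕ × ℕ, ⨆ _ : 1 ≤ p.1 ∧ p.1 ≤ p.2 ∧ p.2 ≤ M + N - 1,
    Isub q M N ext lvl pl p.1 p.2

def OscElt (q : ℂ) (M N : ℕ) (ext : Bool) (lvl : ℕ) (pl : Bool) (m n k u : ℤ) :
    ALG q M N ext lvl :=
  let X : ℕ → ℤ → ALG q M N ext lvl := if pl then XpA q M N ext lvl else XmA q M N ext lvl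
  oscOf q M X m n k u + oscOf q M X m u k n

def Osub (q : ℂ) (M N : ℕ) (ext : Bool) (lvl : ℕ) (pl : Bool) :
    Submodule ℂ (ALG q M N ext lvl) :=
  Submodule.span ℂ
    (Set.range fun p : ℤ × ℤ × ℤ × ℤ => OscElt q M N ext lvl pl p.1 p.2.1 p.2.2.1 p.2.2.2)

/-- the sign `(−1)^{(p(α_k)+p(α_u))·p(α_i)}`. -/
def gsgn (M : ℕ) (k u i : ℕ) : ℂ :=
  if ((k = M ∧ ¬u = M) ∨ (¬k = M ∧ u = M)) ∧ i = M then -1 else 1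

/-! ### Highest weights and the associated eigenvalue sequences -/

/-- `Q·f = 0` for a bilateral formal series `f`. -/
def annih (Q : Polynomial ℂ) (f : ℤ → ℂ) : Prop :=
  ∀ n : ℤ, ∑ s ∈ Finset.range (Q.natDegree + 1), Q.coeff s * f (n - s) = 0

/-- an element of `R_{M,N}`: a highest weight `(P̲, f, c)`. -/
structure HW (q : ℂ) (M N : ℕ) : Type where
  P : ℕ → Polynomial ℂ
  f : ℤ → ℂ
  c : ℂ
  P_const : ∀ i, (P i).coeff 0 = 1
  c_ne : c ≠ 0
  torsion : ∃ Q : Polynomial ℂ, Q ≠ 0 ∧ annih Q f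
  f_zero : f 0 = (c - c⁻¹) / (q - q⁻¹)

def toPS (p : Polynomial ℂ) : PowerSeries ℂ := PowerSeries.mk fun n => p.coeff n

/-- `P(z·u)`. -/
def pscale (u : ℂ) (P : Polynomial ℂ) : Polynomial ℂ := P.comp (Polynomial.C u * Polynomial.X)

/-- the coefficient of `z^n` (`n ≥ 0`) in `q_i^{deg P} P(z q_i⁻¹)/P(z q_i)`,
expanded at `z = 0`. -/
def gammaP (q : ℂ) (M : ℕ) (i : ℕ) (P : Polynomial ℂ) (n : ℤ) : ℂ :=
  if 0 ≤ n then
    qpar q M i ^ P.natDegree *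
      PowerSeries.coeff n.toNat
        (toPS (pscale (qpar q M i)⁻¹ P) * (toPS (pscale (qpar q M i) P))⁻¹)
  else 0

/-- the coefficient of `z^n` (`n ≤ 0`) in `q_i^{deg P} P(z q_i⁻¹)/P(z q_i)`,
expanded at `z = ∞`. -/
def gammaM (q : ℂ) (M : ℕ) (i : ℕ) (P : Polynomial ℂ) (n : ℤ) : ℂ :=
  if n ≤ 0 then
    qpar q M i ^ P.natDegree *
      PowerSeries.coeff (-n).toNat
        (toPS ((pscale (qpar q M i)⁻¹ P).reflect P.natDegree) *
          (toPS ((pscale (qpar q M i) P).reflect P.natDegree))⁻¹)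
  else 0

/-! ### Verma, Weyl and simple modules -/

def vermaRels (q : ℂ) (M N : ℕ) (ext : Bool) (Λ : HW q M N) : Set (ALG q M N ext 3) :=
  {x | ∃ i : ℕ, ∃ n : ℤ, x = XpA q M N ext 3 i n} ∪
  {x | ∃ i : ℕ, ∃ n : ℤ, 1 ≤ i ∧ i ≤ M + N - 1 ∧ i ≠ M ∧
      (x = phiPA q M N ext 3 i n - algebraMap ℂ _ (gammaP q M i (Λ.P i) n) ∨
       x = phiMA q M N ext 3 i n - algebraMap ℂ _ (gammaM q M i (Λ.P i) n))} ∪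
  {x | x = KA q M N ext 3 M - algebraMap ℂ _ Λ.c} ∪
  {x | ∃ n : ℤ, x = phiPA q M N ext 3 M n - phiMA q M N ext 3 M n -
      algebraMap ℂ _ ((q - q⁻¹) * Λ.f n)} ∪
  {x | ext = true ∧ x = K0A q M N ext 3 - 1}

def evenRels (q : ℂ) (M N : ℕ) (ext : Bool) (Λ : HW q M N) : Set (ALG q M N ext 3) :=
  {x | ∃ i : ℕ, 1 ≤ i ∧ i ≤ M + N - 1 ∧ i ≠ M ∧
      x = XmA q M N ext 3 i 0 ^ (1 + (Λ.P i).natDegree)}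

def oddElt (q : ℂ) (M N : ℕ) (ext : Bool) (Q : Polynomial ℂ) (n : ℤ) : ALG q M N ext 3 :=
  ∑ s ∈ Finset.range (Q.natDegree + 1),
    Q.coeff (Q.natDegree - s) • XmA q M N ext 3 M ((s : ℤ) + n)

def oddRels (q : ℂ) (M N : ℕ) (ext : Bool) (Q : Polynomial ℂ) : Set (ALG q M N ext 3) :=
  if M = 1 ∧ N = 1 then {x | ∃ n : ℤ, x = oddElt q M N ext Q n}
  else {oddElt q M N ext Q 0}

def vermaIdeal (q : ℂ) (M N : ℕ) (ext : Bool) (Λ : HW q M N) : Ideal (ALG q M N ext 3) :=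
  Ideal.span (vermaRels q M N ext Λ)

def weylIdeal (q : ℂ) (M N : ℕ) (ext : Bool) (Λ : HW q M N) (Q : Polynomial ℂ) :
    Ideal (ALG q M N ext 3) :=
  Ideal.span (vermaRels q M N ext Λ ∪ evenRels q M N ext Λ ∪ oddRels q M N ext Q)

def uweylIdeal (q : ℂ) (M N : ℕ) (ext : Bool) (Λ : HW q M N) : Ideal (ALG q M N ext 3) :=
  Ideal.span (vermaRels q M N ext Λ ∪ evenRels q M N ext Λ)

/-- the Verma module `M(Λ)`. -/
def VermaMod (q : ℂ) (M N : ℕ) (ext : Bool) (Λ : HW q M N) : Type :=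
  ALG q M N ext 3 ⧸ vermaIdeal q M N ext Λ

/-- the Weyl module `W(Λ; Q)`. -/
def WeylMod (q : ℂ) (M N : ℕ) (ext : Bool) (Λ : HW q M N) (Q : Polynomial ℂ) : Type :=
  ALG q M N ext 3 ⧸ weylIdeal q M N ext Λ Q

/-- the universal Weyl module `W(Λ)`. -/
def UWeylMod (q : ℂ) (M N : ℕ) (ext : Bool) (Λ : HW q M N) : Type :=
  ALG q M N ext 3 ⧸ uweylIdeal q M N ext Λ

instance (q : ℂ) (M N : ℕ) (ext : Bool) (Λ : HW q M N) : AddCommGroup (VermaMod q M N ext Λ) :=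
  inferInstanceAs (AddCommGroup (ALG q M N ext 3 ⧸ vermaIdeal q M N ext Λ))
instance (q : ℂ) (M N : ℕ) (ext : Bool) (Λ : HW q M N) :
    Module (ALG q M N ext 3) (VermaMod q M N ext Λ) :=
  inferInstanceAs (Module (ALG q M N ext 3) (ALG q M N ext 3 ⧸ vermaIdeal q M N ext Λ))
instance (q : ℂ) (M N : ℕ) (ext : Bool) (Λ : HW q M N) : Module ℂ (VermaMod q M N ext Λ) :=
  inferInstanceAs (Module ℂ (ALG q M N ext 3 ⧸ vermaIdeal q M N ext Λ))
instance (q : ℂ) (M N : ℕ) (ext : Bool) (Λ : HW q M N) :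
    IsScalarTower ℂ (ALG q M N ext 3) (VermaMod q M N ext Λ) :=
  inferInstanceAs (IsScalarTower ℂ (ALG q M N ext 3) (ALG q M N ext 3 ⧸ vermaIdeal q M N ext Λ))

instance (q : ℂ) (M N : ℕ) (ext : Bool) (Λ : HW q M N) (Q : Polynomial ℂ) :
    AddCommGroup (WeylMod q M N ext Λ Q) :=
  inferInstanceAs (AddCommGroup (ALG q M N ext 3 ⧸ weylIdeal q M N ext Λ Q))
instance (q : ℂ) (M N : ℕ) (ext : Bool) (Λ : HW q M N) (Q : Polynomial ℂ) :
    Module (ALG q M N ext 3) (WeylMod q M N ext Λ Q) :=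
  inferInstanceAs (Module (ALG q M N ext 3) (ALG q M N ext 3 ⧸ weylIdeal q M N ext Λ Q))
instance (q : ℂ) (M N : ℕ) (ext : Bool) (Λ : HW q M N) (Q : Polynomial ℂ) :
    Module ℂ (WeylMod q M N ext Λ Q) :=
  inferInstanceAs (Module ℂ (ALG q M N ext 3 ⧸ weylIdeal q M N ext Λ Q))
instance (q : ℂ) (M N : ℕ) (ext : Bool) (Λ : HW q M N) (Q : Polynomial ℂ) :
    IsScalarTower ℂ (ALG q M N ext 3) (WeylMod q M N ext Λ Q) :=
  inferInstanceAs
    (IsScalarTower ℂ (ALG q M N ext 3) (ALG q M N ext 3 ⧸ weylIdeal q M N ext Λ Q))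

instance (q : ℂ) (M N : ℕ) (ext : Bool) (Λ : HW q M N) : AddCommGroup (UWeylMod q M N ext Λ) :=
  inferInstanceAs (AddCommGroup (ALG q M N ext 3 ⧸ uweylIdeal q M N ext Λ))
instance (q : ℂ) (M N : ℕ) (ext : Bool) (Λ : HW q M N) :
    Module (ALG q M N ext 3) (UWeylMod q M N ext Λ) :=
  inferInstanceAs (Module (ALG q M N ext 3) (ALG q M N ext 3 ⧸ uweylIdeal q M N ext Λ))
instance (q : ℂ) (M N : ℕ) (ext : Bool) (Λ : HW q M N) : Module ℂ (UWeylMod q M N ext Λ) :=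
  inferInstanceAs (Module ℂ (ALG q M N ext 3 ⧸ uweylIdeal q M N ext Λ))
instance (q : ℂ) (M N : ℕ) (ext : Bool) (Λ : HW q M N) :
    IsScalarTower ℂ (ALG q M N ext 3) (UWeylMod q M N ext Λ) :=
  inferInstanceAs (IsScalarTower ℂ (ALG q M N ext 3) (ALG q M N ext 3 ⧸ uweylIdeal q M N ext Λ))

/-- the highest weight vector (image of `1`). -/
def vgen (q : ℂ) (M N : ℕ) (Λ : HW q M N) : VermaMod q M N true Λ :=
  Submodule.Quotient.mk 1

/-- the sum of all submodules not containing the highest weight vector (the unique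
maximal submodule of the Verma module). -/
def radV (q : ℂ) (M N : ℕ) (Λ : HW q M N) :
    Submodule (ALG q M N true 3) (VermaMod q M N true Λ) :=
  sSup {p | vgen q M N Λ ∉ p}

/-- the simple quotient `S'(Λ)`. -/
def SimpMod (q : ℂ) (M N : ℕ) (Λ : HW q M N) : Type :=
  VermaMod q M N true Λ ⧸ radV q M N Λ

instance (q : ℂ) (M N : ℕ) (Λ : HW q M N) : AddCommGroup (SimpMod q M N Λ) :=
  inferInstanceAs (AddCommGroup (VermaMod q M N true Λ ⧸ radV q M N Λ))
instance (q : ℂ) (M N : ℕ) (Λ : HW q M N) :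
    Module (ALG q M N true 3) (SimpMod q M N Λ) :=
  inferInstanceAs (Module (ALG q M N true 3) (VermaMod q M N true Λ ⧸ radV q M N Λ))
instance (q : ℂ) (M N : ℕ) (Λ : HW q M N) : Module ℂ (SimpMod q M N Λ) :=
  inferInstanceAs (Module ℂ (VermaMod q M N true Λ ⧸ radV q M N Λ))
instance (q : ℂ) (M N : ℕ) (Λ : HW q M N) :
    IsScalarTower ℂ (ALG q M N true 3) (SimpMod q M N Λ) :=
  inferInstanceAs (IsScalarTower ℂ (ALG q M N true 3) (VermaMod q M N true Λ ⧸ radV q M N Λ))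

/-! ### Weight spaces -/

/-- `K_i` for `0 ≤ i`, with `K₀` at `i = 0`. -/
def Kgen (q : ℂ) (M N : ℕ) (ext : Bool) (lvl : ℕ) (i : ℕ) : ALG q M N ext lvl :=
  if i = 0 then K0A q M N ext lvl else KA q M N ext lvl i

/-- the `μ`-weight space of a module. -/
def wtSp (q : ℂ) (M N : ℕ) (ext : Bool) {W : Type} [AddCommGroup W] [Module ℂ W]
    [Module (ALG q M N ext 3) W] [IsScalarTower ℂ (ALG q M N ext 3) W] (μ : ℕ → ℂ) :
    Submodule ℂ W where
  carrier := {w | ∀ i < M + N, Kgen q M N ext 3 i • w = μ i • w}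
  add_mem' := by
    intro a b ha hb i hi
    rw [smul_add, ha i hi, hb i hi, smul_add]
  zero_mem' := by
    intro i hi
    rw [smul_zero, smul_zero]
  smul_mem' := by
    intro c w hw i hi
    have h1 : Kgen q M N ext 3 i • (c • w) = c • (Kgen q M N ext 3 i • w) := by
      rw [← algebraMap_smul (ALG q M N ext 3) c w, ← mul_smul, ← Algebra.commutes, mul_smul,
        algebraMap_smul]
    rw [h1, hw i hi, smul_comm]

/-- the character `λ_Λ`. -/
def lamF (q : ℂ) (M N : ℕ) (Λ : HW q M N) : ℕ → ℂ :=
  fun i => if i = 0 then 1 else if i = M then Λ.c else qpar q M i ^ (Λ.P i).natDegree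

/-- the character `α_j`. -/
def alF (q : ℂ) (M : ℕ) (j : ℕ) : ℕ → ℂ :=
  fun i => if i = 0 then (if j = 1 then q else 1) else q ^ cc M j i

/-! ### The generators of `U` inside `U'` -/

def UGenSet (q : ℂ) (M N : ℕ) : Set (ALG q M N true 3) :=
  {x | (∃ i : ℕ, ∃ n : ℤ, x = XpA q M N true 3 i n) ∨
    (∃ i : ℕ, ∃ n : ℤ, x = XmA q M N true 3 i n) ∨
    (∃ i : ℕ, x = KA q M N true 3 i) ∨ (∃ i : ℕ, x = KiA q M N true 3 i) ∨
    ∃ i : ℕ, ∃ s : ℤ, x = HA q M N true 3 i s}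

/-! ### One-sided presentations (for `U^±`) -/

def XgF (M N : ℕ) (i : ℕ) (n : ℤ) : FreeAlgebra ℂ (Idx M N × ℤ) :=
  if h : 1 ≤ i ∧ i ≤ M + N - 1 then FreeAlgebra.ι ℂ ((⟨i, h⟩, n) : Idx M N × ℤ) else 0

inductive rel1 (q : ℂ) (M N : ℕ) (pl : Bool) :
    FreeAlgebra ℂ (Idx M N × ℤ) → FreeAlgebra ℂ (Idx M N × ℤ) → Prop
  | comm0 (i j : Idx M N) (m n : ℤ) (h : cc M i.1 j.1 = 0) :
      rel1 q M N pl
        (FreeAlgebra.ι ℂ ((i, m) : Idx M N × ℤ) * FreeAlgebra.ι ℂ ((j, n) : Idx M N × ℤ) -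
          sgn M i.1 j.1 •
            (FreeAlgebra.ι ℂ ((j, n) : Idx M N × ℤ) * FreeAlgebra.ι ℂ ((i, m) : Idx M N × ℤ))) 0
  | deg2 (i j : Idx M N) (m n : ℤ) (h : cc M i.1 j.1 ≠ 0) :
      rel1 q M N pl
        (FreeAlgebra.ι ℂ ((i, m + 1) : Idx M N × ℤ) * FreeAlgebra.ι ℂ ((j, n) : Idx M N × ℤ) -
          (q ^ (if pl then cc M i.1 j.1 else -cc M i.1 j.1)) •
            (FreeAlgebra.ι ℂ ((j, n) : Idx M N × ℤ) *
              FreeAlgebra.ι ℂ ((i, m + 1) : Idx M N × ℤ)))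
        ((q ^ (if pl then cc M i.1 j.1 else -cc M i.1 j.1)) •
            (FreeAlgebra.ι ℂ ((i, m) : Idx M N × ℤ) *
              FreeAlgebra.ι ℂ ((j, n + 1) : Idx M N × ℤ)) -
          FreeAlgebra.ι ℂ ((j, n + 1) : Idx M N × ℤ) * FreeAlgebra.ι ℂ ((i, m) : Idx M N × ℤ))
  | serre (i j : Idx M N) (m n k : ℤ) (h : cc M i.1 j.1 = 1 ∨ cc M i.1 j.1 = -1)
      (hi : i.1 ≠ M) :
      rel1 q M N pl
        (brF q (FreeAlgebra.ι ℂ ((i, m) : Idx M N × ℤ))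
            (brF q⁻¹ (FreeAlgebra.ι ℂ ((i, n) : Idx M N × ℤ))
              (FreeAlgebra.ι ℂ ((j, k) : Idx M N × ℤ))) +
          brF q (FreeAlgebra.ι ℂ ((i, n) : Idx M N × ℤ))
            (brF q⁻¹ (FreeAlgebra.ι ℂ ((i, m) : Idx M N × ℤ))
              (FreeAlgebra.ι ℂ ((j, k) : Idx M N × ℤ)))) 0
  | osc (m n k u : ℤ) (hM : 1 < M) (hN : 1 < N) :
      rel1 q M N pl (oscOf q M (XgF M N) m n k u + oscOf q M (XgF M N) m u k n) 0

end QAS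

namespace QAS

/-- the subspace `V⁻V⁰V⁺O⁺V⁺` of `V`. -/
def Tplus7 (q : ℂ) (M N : ℕ) : Submodule ℂ (ALG q M N false 2) :=
  Subalgebra.toSubmodule (Aminus q M N false 2) * Subalgebra.toSubmodule (Azero q M N false 2) *
    Subalgebra.toSubmodule (Aplus q M N false 2) * Osub q M N false 2 true *
    Subalgebra.toSubmodule (Aplus q M N false 2)

/-- the subspace `V⁻O⁻V⁻V⁰V⁺` of `V`. -/
def Tminus7 (q : ℂ) (M N : ℕ) : Submodule ℂ (ALG q M N false 2) :=
  Subalgebra.toSubmodule (Aminus q M N false 2) * Osub q M N false 2 false *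
    Subalgebra.toSubmodule (Aminus q M N false 2) * Subalgebra.toSubmodule (Azero q M N false 2) *
    Subalgebra.toSubmodule (Aplus q M N false 2)

end QAS


namespace OT

set_option linter.unusedSimpArgs false
set_option linter.unusedSectionVars false

section abstract
variable {R : Type} [Ring R] [Algebra ℂ R]

/-- the symmetric quartic word. -/
def Gw (p : ℂ) (a c b d : R) : R :=
  p • (a * b * c * d + c * b * a * d + b * a * d * c + b * c * d * a)
    - (p ^ 2 + 1) • (b * a * c * d)

def Sw (p : ℂ) (a c b d : R) : R := Gw p a c b d + Gw p a c d b

/-- the word obtained by applying the odd derivation. -/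
def Fw (p : ℂ) (a c b f : R) : R :=
  p • (a * b * c * f + c * b * a * f + b * a * f * c + b * c * f * a
      - a * f * c * b - c * f * a * b - f * a * b * c - f * c * b * a)
    - (p ^ 2 + 1) • (b * a * c * f - f * a * c * b)

def QR (p : ℂ) (f b : ℤ → R) : Prop := ∀ m n : ℤ,
  f (m + 1) * b n - p • (b n * f (m + 1)) - p • (f m * b (n + 1)) + b (n + 1) * f m = 0

theorem vanish (a b c d : ℂ) (ha : a ≠ 0) (hd : d ≠ 0) (T : ℤ → ℤ → ℤ → R)
    (hT : ∀ m n u, a • T (m + 2) n u + b • T (m + 1) (n + 1) u + c • T (m + 1) n (u + 1)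
      + d • T m (n + 1) (u + 1) = 0)
    (h0 : (∀ m < 0, ∀ n u, T m n u = 0) ∨ (∀ m > 0, ∀ n u, T m n u = 0)) :
    ∀ m n u, T m n u = 0 := by
  rcases h0 with h0 | h0
  · have key : ∀ k : ℕ, ∀ m : ℤ, m < k → ∀ n u, T m n u = 0 := by
      intro k
      induction k with
      | zero => intro m hm; exact h0 m (by simpa using hm)
      | succ k ih =>
        intro m hm n u
        have h := hT (m - 2) n u
        rw [show m - 2 + 2 = m by ring, show m - 2 + 1 = m - 1 by ring,
          ih (m - 1) (by push_cast at hm; omega), ih (m - 1) (by push_cast at hm; omega),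
          ih (m - 2) (by push_cast at hm; omega)] at h
        simpa [ha] using h
    intro m
    exact key (m.toNat + 1) m (by push_cast; omega)
  · have key : ∀ k : ℕ, ∀ m : ℤ, -(k : ℤ) < m → ∀ n u, T m n u = 0 := by
      intro k
      induction k with
      | zero => intro m hm; exact h0 m (by simpa using hm)
      | succ k ih =>
        intro m hm n u
        have h := hT m (n - 1) (u - 1)
        rw [ih (m + 1) (by push_cast at hm; omega), ih (m + 1) (by push_cast at hm; omega),
          ih (m + 2) (by push_cast at hm; omega)] at h
        simpa [hd] using h
    intro m
    exact key ((-m).toNat + 1) m (by push_cast; omega)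

theorem E1 (p : ℂ) (b0 b1 d0 d1 c0 c1 : R)
    (h1 : p • (c1 * b0) - b0 * c1 - c0 * b1 + p • (b1 * c0) = 0)
    (h2 : p • (c1 * d0) - d0 * c1 - c0 * d1 + p • (d1 * c0) = 0)
    (h00 : b0 * d0 + d0 * b0 = 0) (h01 : b0 * d1 + d1 * b0 = 0) (h10 : b1 * d0 + d0 * b1 = 0) :
    p • (c0 * b0 * d1 - c0 * b1 * d0 + b0 * d1 * c0 - b1 * d0 * c0) + p ^ 2 • (b1 * c0 * d0)
      - b0 * c0 * d1 + p ^ 2 • (d1 * c0 * b0) - d0 * c0 * b1 = 0 := by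
  linear_combination (norm := (simp only [mul_add, add_mul, mul_sub, sub_mul, mul_zero, zero_mul,
    smul_mul_assoc, mul_smul_comm, mul_assoc, smul_zero]; module))
    p • (c0 * h01) + p • (h1 * d0) + p • (h2 * b0) - p • p • (c1 * h00) + b0 * h2 + d0 * h1
    - p • (h10 * c0) + h00 * c1

theorem assocR {x y : R} (h : x * y = y * x) (z : R) : x * (y * z) = y * (x * z) := by
  rw [← mul_assoc, h, mul_assoc]

theorem E2 (p : ℂ) (a0 a1 b0 b1 c0 c1 : R)
    (hA : a1 * b0 - p • (b0 * a1) - p • (a0 * b1) + b1 * a0 = 0)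
    (hC : p • (c1 * b0) - b0 * c1 - c0 * b1 + p • (b1 * c0) = 0)
    (h00 : a0 * c0 = c0 * a0) (h01 : a0 * c1 = c1 * a0) (h10 : a1 * c0 = c0 * a1) :
    p • (a0 * b0 * c1 - a1 * b0 * c0 + c1 * b0 * a0 - c0 * b0 * a1) + p ^ 2 • (b0 * a1 * c0)
      - b0 * a0 * c1 + a1 * c0 * b0 - p ^ 2 • (a0 * c1 * b0) = 0 := by
  linear_combination (norm := (simp only [mul_add, add_mul, mul_sub, sub_mul, mul_zero, zero_mul,
    smul_mul_assoc, mul_smul_comm, mul_assoc, smul_zero, h00, h01, h10,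
    assocR h00, assocR h01, assocR h10]; module))
    -p • (a0 * hC) - p • (hA * c0) + hC * a0 + c0 * hA

/-- recursion for the word with `a` replaced by `f`. -/
theorem recS (p : ℂ) (f0 f1 f2 b0 b1 d0 d1 c0 c1 : R)
    (h1 : p • (c1 * b0) - b0 * c1 - c0 * b1 + p • (b1 * c0) = 0)
    (h2 : p • (c1 * d0) - d0 * c1 - c0 * d1 + p • (d1 * c0) = 0)
    (h00 : b0 * d0 + d0 * b0 = 0) (h01 : b0 * d1 + d1 * b0 = 0) (h10 : b1 * d0 + d0 * b1 = 0)
    (h11 : b1 * d1 + d1 * b1 = 0)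
    (hf0 : f0 * c0 = c0 * f0) (hf1 : f1 * c0 = c0 * f1) (hf2 : f2 * c0 = c0 * f2)
    (hb1 : f1 * b0 - p • (b0 * f1) - p • (f0 * b1) + b1 * f0 = 0)
    (hb2 : f2 * b0 - p • (b0 * f2) - p • (f1 * b1) + b1 * f1 = 0)
    (hd1 : f1 * d0 - p • (d0 * f1) - p • (f0 * d1) + d1 * f0 = 0)
    (hd2 : f2 * d0 - p • (d0 * f2) - p • (f1 * d1) + d1 * f1 = 0) :
    Sw p f2 c0 b0 d0 - p • Sw p f1 c0 b1 d0 - p • Sw p f1 c0 b0 d1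
      + p ^ 2 • Sw p f0 c0 b1 d1 = 0 := by
  have e := E1 p b0 b1 d0 d1 c0 c1 h1 h2 h00 h01 h10
  have g0 : d0 * b0 = -(b0 * d0) := by linear_combination (norm := abel) h00
  have g1 : d1 * b0 = -(b0 * d1) := by linear_combination (norm := abel) h01
  have g2 : d0 * b1 = -(b1 * d0) := by linear_combination (norm := abel) h10
  have g3 : d1 * b1 = -(b1 * d1) := by linear_combination (norm := abel) h11
  have as : ∀ x y z w t: R, x * y = -(z * w) → x * (y * t) = -(z * (w * t)) := by
    intro x y z w t h
    rw [← mul_assoc, h, neg_mul, mul_assoc]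
  unfold Sw Gw
  linear_combination (norm := (simp only [mul_add, add_mul, mul_sub, sub_mul, mul_zero, zero_mul,
    smul_mul_assoc, mul_smul_comm, mul_assoc, smul_zero, hf0, hf1, hf2, assocR hf0, assocR hf1,
    assocR hf2, g0, g1, g2, g3, as _ _ _ _ _ g0, as _ _ _ _ _ g1, as _ _ _ _ _ g2,
    as _ _ _ _ _ g3, mul_neg, neg_mul]; module))
    -- word 1
    p • (hb2 * c0 * d0 - p • (hb1 * c0 * d1) + p • (b0 * c0 * hd2) - b1 * c0 * hd1)
    + p • (hd2 * c0 * b0 - p • (hd1 * c0 * b1) + p • (d0 * c0 * hb2) - d1 * c0 * hb1)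
    -- word 2
    + p • (c0 * b0 * hd2 - p • (c0 * b1 * hd1)) + p • (c0 * d0 * hb2 - p • (c0 * d1 * hb1))
    -- word 3
    + p • (b0 * hd2 * c0 - p • (b1 * hd1 * c0)) + p • (d0 * hb2 * c0 - p • (d1 * hb1 * c0))
    -- word 5
    - (p ^ 2 + 1) • (b0 * c0 * hd2 - p • (b1 * c0 * hd1))
    - (p ^ 2 + 1) • (d0 * c0 * hb2 - p • (d1 * c0 * hb1))
    + (p ^ 2 - 1) • (e * f1)

/-- recursion for the word with one `b` replaced by `f`. -/
theorem recF (p : ℂ) (f0 f1 f2 a0 a1 b0 b1 c0 c1 : R)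
    (hA : a1 * b0 - p • (b0 * a1) - p • (a0 * b1) + b1 * a0 = 0)
    (hC : p • (c1 * b0) - b0 * c1 - c0 * b1 + p • (b1 * c0) = 0)
    (h00 : a0 * c0 = c0 * a0) (h01 : a0 * c1 = c1 * a0) (h10 : a1 * c0 = c0 * a1)
    (h11 : a1 * c1 = c1 * a1)
    (hf0 : f0 * b0 = b0 * f0) (hf1 : f1 * b0 = b0 * f1) (hf2 : f2 * b0 = b0 * f2)
    (ha1 : f1 * a0 - p • (a0 * f1) - p • (f0 * a1) + a1 * f0 = 0)
    (ha2 : f2 * a0 - p • (a0 * f2) - p • (f1 * a1) + a1 * f1 = 0)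
    (hc1 : p • (f1 * c0) - c0 * f1 - f0 * c1 + p • (c1 * f0) = 0)
    (hc2 : p • (f2 * c0) - c0 * f2 - f1 * c1 + p • (c1 * f1) = 0) :
    p • Fw p a0 c0 b0 f2 - p ^ 2 • Fw p a1 c0 b0 f1 - Fw p a0 c1 b0 f1
      + p • Fw p a1 c1 b0 f0 = 0 := by
  have e := E2 p a0 a1 b0 b1 c0 c1 hA hC h00 h01 h10
  unfold Fw
  linear_combination (norm := (simp only [mul_add, add_mul, mul_sub, sub_mul, mul_zero, zero_mul,
    smul_mul_assoc, mul_smul_comm, mul_assoc, smul_zero, hf0, hf1, hf2, assocR hf0, assocR hf1,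
    assocR hf2, h00, h01, h10, h11, assocR h00, assocR h01, assocR h10, assocR h11]; module))
    p • (b0 * a0 * hc2 - p • (b0 * a1 * hc1))
    + p • (p • (b0 * c0 * ha2) - b0 * c1 * ha1)
    - p • (a0 * hc2 * b0 - p • (a1 * hc1 * b0))
    - p • (p • (c0 * ha2 * b0) - c1 * ha1 * b0)
    - p • (p • (ha2 * b0 * c0) - ha1 * b0 * c1 + p • (a0 * b0 * hc2) - a1 * b0 * hc1)
    - p • (hc2 * b0 * a0 - p • (hc1 * b0 * a1) + c0 * b0 * ha2 - p • (c1 * b0 * ha1))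
    + (p ^ 2 + 1) • (p • (ha2 * c0 * b0) - ha1 * c1 * b0 + p • (a0 * hc2 * b0) - a1 * hc1 * b0)
    + (p ^ 2 - 1) • (e * f1)

theorem QRinv {p : ℂ} (hp : p ≠ 0) {f b : ℤ → R} (h : QR p⁻¹ f b) (m n : ℤ) :
    p • (f (m + 1) * b n) - b n * f (m + 1) - f m * b (n + 1) + p • (b (n + 1) * f m) = 0 := by
  have h' := congrArg (fun x => p • x) (h m n)
  simpa only [smul_add, smul_sub, smul_smul, mul_inv_cancel₀ hp, one_smul, smul_zero] using h'

theorem Svan {p : ℂ} (hp : p ≠ 0) {f b c : ℤ → R} (hfb : QR p f b) (hcb : QR p⁻¹ c b)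
    (hfc : ∀ m k, f m * c k = c k * f m) (hbb : ∀ n u, b n * b u + b u * b n = 0)
    (h0 : (∀ m < 0, f m = 0) ∨ (∀ m > 0, f m = 0)) (m n k u : ℤ) :
    Sw p (f m) (c k) (b n) (b u) = 0 := by
  refine vanish 1 (-p) (-p) (p ^ 2) one_ne_zero (pow_ne_zero 2 hp)
    (fun m n u => Sw p (f m) (c k) (b n) (b u)) ?_ ?_ m n u
  · intro m n u
    have hb2 := hfb (m + 1) n
    have hd2 := hfb (m + 1) u
    rw [show m + 1 + 1 = m + 2 by ring] at hb2 hd2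
    have := recS p (f m) (f (m + 1)) (f (m + 2)) (b n) (b (n + 1)) (b u) (b (u + 1)) (c k)
      (c (k + 1)) (QRinv hp hcb k n) (QRinv hp hcb k u) (hbb _ _) (hbb _ _) (hbb _ _) (hbb _ _)
      (hfc _ _) (hfc _ _) (hfc _ _) (hfb m n) hb2 (hfb m u) hd2
    linear_combination (norm := module) this
  · refine h0.imp ?_ ?_ <;> intro h m hm n u <;> simp [h m hm, Sw, Gw]

theorem Fvan {p : ℂ} (hp : p ≠ 0) {f a b c : ℤ → R} (hfa : QR p f a) (hfc : QR p⁻¹ f c)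
    (hab : QR p a b) (hcb : QR p⁻¹ c b)
    (hfb : ∀ m k, f m * b k = b k * f m) (hac : ∀ m k, a m * c k = c k * a m)
    (h0 : (∀ m < 0, f m = 0) ∨ (∀ m > 0, f m = 0)) (m n k u : ℤ) :
    Fw p (a m) (c k) (b n) (f u) = 0 := by
  refine vanish p (-p ^ 2) (-1) p hp hp
    (fun u m k => Fw p (a m) (c k) (b n) (f u)) ?_ ?_ u m k
  · intro u m k
    have hb2 := hfa (u + 1) m
    have hd2 := QRinv hp hfc (u + 1) k
    rw [show u + 1 + 1 = u + 2 by ring] at hb2 hd2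
    have := recF p (f u) (f (u + 1)) (f (u + 2)) (a m) (a (m + 1)) (b n) (b (n + 1)) (c k)
      (c (k + 1)) (hab m n) (QRinv hp hcb k n) (hac _ _) (hac _ _) (hac _ _) (hac _ _)
      (hfb _ _) (hfb _ _) (hfb _ _) (hfa u m) hb2 (QRinv hp hfc u k) hd2
    linear_combination (norm := module) this
  · refine h0.imp ?_ ?_ <;> intro h m hm n u <;> simp [h m hm, Fw]

theorem Sw_inv {p : ℂ} (hp : p ≠ 0) (a c b d : R) : Sw p a c b d = p ^ 2 • Sw p⁻¹ a c b d := by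
  unfold Sw Gw
  match_scalars <;> field_simp <;> ring

theorem Sw_swap {p : ℂ} (a c b d : R) (h : a * c = c * a) : Sw p a c b d = Sw p c a b d := by
  unfold Sw Gw
  simp only [mul_assoc, h, assocR h]
  module

theorem Sw_comm_left (p : ℂ) (a c b d y : R) (hc : c * y = y * c) (hb : b * y = y * b)
    (hd : d * y = y * d) :
    Sw p a c b d * y - y * Sw p a c b d = Sw p (a * y - y * a) c b d := by
  unfold Sw Gw
  simp only [mul_add, add_mul, mul_sub, sub_mul, smul_mul_assoc, mul_smul_comm, mul_assoc, hc, hb,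
    hd, assocR hc, assocR hb, assocR hd]
  module

theorem Sw_lin (p e : ℂ) (x y c b d : R) :
    Sw p (e • (x - y)) c b d = e • (Sw p x c b d - Sw p y c b d) := by
  unfold Sw Gw
  simp only [mul_sub, sub_mul, smul_mul_assoc, mul_smul_comm, mul_assoc]
  module

theorem Fw_lin (p e : ℂ) (a c b x y : R) :
    Fw p a c b (e • (x - y)) = e • (Fw p a c b x - Fw p a c b y) := by
  unfold Fw
  simp only [mul_sub, sub_mul, smul_mul_assoc, mul_smul_comm, mul_assoc]
  module

theorem Sw_comm_mid (p : ℂ) (a c b d y : R) (hc : c * y = y * c) (ha : a * y = y * a) :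
    Sw p a c b d * y - y * Sw p a c b d =
      Fw p a c b (d * y + y * d) + Fw p a c d (b * y + y * b) := by
  unfold Sw Gw Fw
  simp only [mul_add, add_mul, mul_sub, sub_mul, smul_mul_assoc, mul_smul_comm, mul_assoc, hc,
    ha, assocR hc, assocR ha]
  module

theorem osc_Sw {q : ℂ} (hq : q ≠ 0) (a c b d : R) (hac : a * c = c * a)
    (hbd : b * d + d * b = 0) :
    (QAS.brF q (QAS.brF q⁻¹ a b) c * d + d * QAS.brF q (QAS.brF q⁻¹ a b) c) +
    (QAS.brF q (QAS.brF q⁻¹ a d) c * b + b * QAS.brF q (QAS.brF q⁻¹ a d) c)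
      = q⁻¹ • Sw q a c b d := by
  unfold QAS.brF Sw Gw
  linear_combination (norm := skip) -q • (c * a * hbd) - q⁻¹ • (hbd * a * c)
  simp only [mul_add, add_mul, mul_sub, sub_mul, smul_mul_assoc, mul_smul_comm, mul_assoc, hac,
    assocR hac, mul_zero, zero_mul, smul_zero]
  match_scalars <;> field_simp <;> ring

/-- separating the two halves of the current. -/
theorem QRsep {p : ℂ} (hp : p ≠ 0) {P Q x : ℤ → R} (h : QR p (fun m => P m - Q m) x)
    (hP : ∀ m < 0, P m = 0) (hQ : ∀ m > 0, Q m = 0)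
    (hP0 : ∀ n, P 0 * x n = p • (x n * P 0)) (hQ0 : ∀ n, Q 0 * x n = p⁻¹ • (x n * Q 0)) :
    QR p P x ∧ QR p Q x := by
  have key : QR p Q x → QR p P x := by
    intro hq m n
    have h1 := h m n
    have h2 := hq m n
    simp only [mul_sub, sub_mul] at h1
    linear_combination (norm := module) h1 + h2
  have hQR : QR p Q x := by
    intro m n
    rcases lt_trichotomy m 0 with hm | hm | hm
    · rcases eq_or_lt_of_le (show m ≤ -1 by omega) with hm' | hm'
      · have h1 := h m n
        subst hm'
        simp only [hP (-1) (by norm_num), mul_sub, sub_mul] at h1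
        have h0 := hP0 n
        rw [show (-1 : ℤ) + 1 = 0 by norm_num] at h1 ⊢
        rw [h0] at h1
        simp only [zero_mul, mul_zero, smul_zero, zero_sub] at h1
        linear_combination (norm := module) -h1
      · have h1 := h m n
        simp only [hP m hm, hP (m + 1) (by omega), zero_sub, neg_mul, mul_neg, smul_neg] at h1
        linear_combination (norm := module) -h1
    · subst hm
      rw [hQ (0 + 1) (by norm_num), hQ0]
      simp [smul_smul, hp]
    · simp [hQ m hm, hQ (m + 1) (by omega)]
  exact ⟨key hQR, hQR⟩

/-- transport of a quadratic relation through a derivation. -/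
theorem QRder {p s e : ℂ} (he : e ≠ 0) {x z f : ℤ → R} {y : R} (h : QR p x z)
    (hz : ∀ n, z n * y = y * z n) (hx : ∀ n, x n * y - s • (y * x n) = e • f n) : QR p f z := by
  intro m n
  have h0 := h m n
  have h1 := hx m
  have h2 := hx (m + 1)
  have key : e • (f (m + 1) * z n - p • (z n * f (m + 1)) - p • (f m * z (n + 1)) +
      z (n + 1) * f m) = 0 := by
    linear_combination (norm := skip) h0 * y - s • (y * h0) - h2 * z n + p • (z n * h2)
      + p • (h1 * z (n + 1)) - z (n + 1) * h1
    simp only [mul_add, add_mul, mul_sub, sub_mul, smul_mul_assoc, mul_smul_comm, mul_assoc, hz,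
      assocR (hz _), mul_zero, zero_mul, smul_zero]
    module
  exact (smul_eq_zero.mp key).resolve_left he

end abstract
end OT
namespace OT
open QAS

section concrete
variable (q : ℂ) (M N : ℕ)

abbrev V := ALG q M N false 2

def X (pl : Bool) : ℕ → ℤ → V q M N :=
  if pl then XpA q M N false 2 else XmA q M N false 2

def sg (pl : Bool) : ℤ := if pl then 1 else -1

theorem sg_not (pl : Bool) : sg (!pl) = -sg pl := by cases pl <;> rfl

theorem mk_rel {x y : FA M N false} (h : rel q M N false 2 x y) :
    mkA q M N false 2 x = mkA q M N false 2 y := RingQuot.mkAlgHom_rel ℂ h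

theorem innerE_comm (i j : ℕ) : innerE M i j = innerE M j i := by
  unfold innerE
  by_cases h : i = j
  · rw [h]
  · rw [if_neg h, if_neg (Ne.symm h)]

theorem cc_comm (i j : ℕ) : cc M i j = cc M j i := by
  unfold cc form4
  rw [innerE_comm M i j, innerE_comm M i (j + 1), innerE_comm M (i + 1) j,
    innerE_comm M (i + 1) (j + 1)]
  ring

theorem sgn_comm (i j : ℕ) : sgn M i j = sgn M j i := by
  unfold sgn; simp only [and_comm]

theorem sgn_ne {i j : ℕ} (h : i ≠ j) : sgn M i j = 1 := by
  unfold sgn; rw [if_neg]; omega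

theorem KX (pl : Bool) (i j : ℕ) (n : ℤ) : KA q M N false 2 i * X q M N pl j n =
    q ^ (sg pl * cc M i j) • (X q M N pl j n * KA q M N false 2 i) := by
  cases pl <;> simp only [X, KA, XpA, XmA, KF, XpF, XmF, sg, if_true, Bool.false_eq_true, if_false]
  · split_ifs with h1 h2
    · simpa using mk_rel q M N (rel.KXm ⟨i, h1⟩ ⟨j, h2⟩ n)
    all_goals simp
  · split_ifs with h1 h2
    · simpa using mk_rel q M N (rel.KXp ⟨i, h1⟩ ⟨j, h2⟩ n)
    all_goals simp

theorem KiX (hq : q ≠ 0) (pl : Bool) (i j : ℕ) (n : ℤ) : KiA q M N false 2 i * X q M N pl j n =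
    (q ^ (sg pl * cc M i j))⁻¹ • (X q M N pl j n * KiA q M N false 2 i) := by
  by_cases h : 1 ≤ i ∧ i ≤ M + N - 1
  · have h1 : KA q M N false 2 i * KiA q M N false 2 i = 1 := by
      simpa [KA, KiA, KF, KiF, h] using mk_rel q M N (rel.KKi ⟨i, h⟩)
    have h2 : KiA q M N false 2 i * KA q M N false 2 i = 1 := by
      simpa [KA, KiA, KF, KiF, h] using mk_rel q M N (rel.KiK ⟨i, h⟩)
    have h3 := KX q M N pl i j n
    have hne : q ^ (sg pl * cc M i j) ≠ 0 := zpow_ne_zero _ hq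
    have h4 : X q M N pl j n * KiA q M N false 2 i =
        q ^ (sg pl * cc M i j) • (KiA q M N false 2 i * X q M N pl j n) := by
      calc X q M N pl j n * KiA q M N false 2 i
          = KiA q M N false 2 i * (KA q M N false 2 i * X q M N pl j n)
              * KiA q M N false 2 i := by rw [← mul_assoc, h2, one_mul]
        _ = _ := by
          rw [h3, mul_smul_comm, smul_mul_assoc, mul_assoc, mul_assoc, h1, mul_one]
    rw [h4, smul_smul, inv_mul_cancel₀ hne, one_smul]
  · simp [KiA, KiF, h]

theorem HX (pl : Bool) (i j : ℕ) (s : ℤ) : ∃ c : ℂ, (cc M i j = 0 → c = 0) ∧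
    ∀ n, HA q M N false 2 i s * X q M N pl j n - X q M N pl j n * HA q M N false 2 i s =
      c • X q M N pl j (n + s) := by
  by_cases h1 : (1 ≤ i ∧ i ≤ M + N - 1) ∧ s ≠ 0
  · refine ⟨(sg pl : ℂ) * (qint (qpar q M i) (s * lof M i * cc M i j) / (s : ℂ)), ?_, ?_⟩
    · intro h; simp [h, qint]
    intro n
    cases pl <;> simp only [X, HA, XpA, XmA, HF, XpF, XmF, sg, if_true, Bool.false_eq_true,
      if_false, dif_pos h1]
    · split_ifs with h2
      · have := mk_rel q M N (rel.HXm ⟨i, h1.1⟩ ⟨j, h2⟩ ⟨s, h1.2⟩ n)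
        simp only [map_sub, map_mul, map_neg, map_smul] at this
        rw [this]
        push_cast
        module
      · simp
    · split_ifs with h2
      · simpa only [map_sub, map_mul, map_neg, map_smul, Int.cast_neg, Int.cast_one, neg_mul,
          one_mul, neg_smul] using mk_rel q M N (rel.HXp ⟨i, h1.1⟩ ⟨j, h2⟩ ⟨s, h1.2⟩ n)
      · simp
  · exact ⟨0, fun _ => rfl, fun n => by simp [HA, HF, dif_neg h1]⟩

theorem XX0 (pl : Bool) (i j : ℕ) (h : cc M i j = 0) (m n : ℤ) :
    X q M N pl i m * X q M N pl j n = sgn M i j • (X q M N pl j n * X q M N pl i m) := by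
  cases pl <;> simp only [X, XpA, XmA, XpF, XmF, if_true, Bool.false_eq_true, if_false]
  · split_ifs with h1 h2
    · have := mk_rel q M N (rel.XX0m ⟨i, h1⟩ ⟨j, h2⟩ m n le_rfl h)
      rw [← sub_eq_zero]
      simpa only [map_sub, map_mul, map_smul, map_zero] using this
    all_goals simp
  · split_ifs with h1 h2
    · have := mk_rel q M N (rel.XX0p ⟨i, h1⟩ ⟨j, h2⟩ m n le_rfl h)
      rw [← sub_eq_zero]
      simpa only [map_sub, map_mul, map_smul, map_zero] using this
    all_goals simp

theorem XXQ (pl : Bool) (i j : ℕ) (h : cc M i j ≠ 0) :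
    QR (q ^ (sg pl * cc M i j)) (X q M N pl i) (X q M N pl j) := by
  intro m n
  cases pl <;> simp only [X, XpA, XmA, XpF, XmF, if_true, Bool.false_eq_true, if_false, sg,
    one_mul, neg_mul]
  · split_ifs with h1 h2
    · have := mk_rel q M N (rel.XXm ⟨i, h1⟩ ⟨j, h2⟩ m n le_rfl h)
      simp only [map_sub, map_mul, map_smul] at this
      linear_combination (norm := module) this
    all_goals simp
  · split_ifs with h1 h2
    · have := mk_rel q M N (rel.XXp ⟨i, h1⟩ ⟨j, h2⟩ m n le_rfl h)
      simp only [map_sub, map_mul, map_smul] at this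
      linear_combination (norm := module) this
    all_goals simp

theorem PMne (pl : Bool) {i j : ℕ} (h : i ≠ j) (m n : ℤ) :
    X q M N pl i m * X q M N (!pl) j n = X q M N (!pl) j n * X q M N pl i m := by
  have key : ∀ i j : ℕ, i ≠ j → ∀ m n, XpA q M N false 2 i m * XmA q M N false 2 j n =
      XmA q M N false 2 j n * XpA q M N false 2 i m := by
    intro i j h m n
    simp only [XpA, XmA, XpF, XmF]
    split_ifs with h1 h2
    · have := mk_rel q M N (rel.XpXm ⟨i, h1⟩ ⟨j, h2⟩ m n)
      rw [if_neg (by simpa using h), sgn_ne M h] at this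
      rw [← sub_eq_zero]
      simpa only [map_sub, map_mul, one_smul, map_zero] using this
    all_goals simp
  cases pl
  · exact (key j i h.symm n m).symm
  · exact key i j h m n

theorem qi_ne (hq : q ≠ 0) (hq2 : q ^ 2 ≠ 1) (i : ℕ) : qpar q M i - (qpar q M i)⁻¹ ≠ 0 := by
  unfold qpar lof
  have : q - q⁻¹ ≠ 0 := by
    intro h
    apply hq2
    field_simp at h
    linear_combination h
  split_ifs
  · simpa using this
  · intro h
    apply this
    simp only [zpow_neg, zpow_one, inv_inv] at h
    linear_combination -h

theorem PM (hq : q ≠ 0) (hq2 : q ^ 2 ≠ 1) (pl : Bool) (i : ℕ) : ∃ e : ℂ, e ≠ 0 ∧ ∀ m n : ℤ,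
    X q M N pl i m * X q M N (!pl) i n - sgn M i i • (X q M N (!pl) i n * X q M N pl i m) =
      e • (phiPA q M N false 2 i (m + n) - phiMA q M N false 2 i (m + n)) := by
  have key : ∀ m n, XpA q M N false 2 i m * XmA q M N false 2 i n -
      sgn M i i • (XmA q M N false 2 i n * XpA q M N false 2 i m) =
      (qpar q M i - (qpar q M i)⁻¹)⁻¹ •
        (phiPA q M N false 2 i (m + n) - phiMA q M N false 2 i (m + n)) := by
    intro m n
    by_cases h1 : 1 ≤ i ∧ i ≤ M + N - 1
    · have := mk_rel q M N (rel.XpXm ⟨i, h1⟩ ⟨i, h1⟩ m n)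
      rw [if_pos rfl] at this
      simpa only [XpA, XmA, XpF, XmF, dif_pos h1, phiPA, phiMA, map_sub, map_mul, map_smul]
        using this
    · simp [XpA, XmA, XpF, XmF, dif_neg h1, phiPA, phiMA, phiPF, phiMF, KF, KiF]
  have hne := inv_ne_zero (qi_ne q M hq hq2 i)
  have hs : sgn M i i * sgn M i i = 1 := by unfold sgn; split_ifs <;> norm_num
  cases pl
  · refine ⟨-sgn M i i * (qpar q M i - (qpar q M i)⁻¹)⁻¹, ?_, ?_⟩
    · exact mul_ne_zero (neg_ne_zero.mpr (left_ne_zero_of_mul_eq_one hs)) hne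
    · intro m n
      rw [mul_smul, add_comm m n, ← key n m, smul_sub, smul_smul, neg_mul, hs]
      simp only [X, Bool.not_false, if_true, Bool.false_eq_true, if_false]
      module
  · exact ⟨_, hne, key⟩

theorem expC_mem {A : Type} [Ring A] [Algebra ℂ A] (S : Subalgebra ℂ A) (t : ℂ) (a : ℕ → A)
    (ha : ∀ n, a n ∈ S) (n : ℕ) : expC t a n ∈ S := by
  induction n using Nat.strong_induction_on with
  | _ n ih =>
    cases n with
    | zero => rw [expC]; exact S.one_mem
    | succ n =>
      rw [expC]
      refine S.smul_mem (S.smul_mem (S.sum_mem fun s hs => S.smul_mem (S.mul_mem (ha _) ?_) _) _) _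
      exact ih _ (by omega)

theorem phi_mem (S : Subalgebra ℂ (V q M N)) (i : ℕ) (hK : KA q M N false 2 i ∈ S)
    (hKi : KiA q M N false 2 i ∈ S) (hH : ∀ s, HA q M N false 2 i s ∈ S) (n : ℤ) :
    phiPA q M N false 2 i n ∈ S ∧ phiMA q M N false 2 i n ∈ S := by
  constructor
  · change phiPF q M N false i n ∈ S.comap (mkA q M N false 2)
    unfold phiPF
    split_ifs
    · exact mul_mem hK (expC_mem (S.comap (mkA q M N false 2)) _ _ (fun s => hH s) _)
    · exact zero_mem _
  · change phiMF q M N false i n ∈ S.comap (mkA q M N false 2)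
    unfold phiMF
    split_ifs
    · exact mul_mem hKi (expC_mem (S.comap (mkA q M N false 2)) _ _ (fun s => hH (-s)) _)
    · exact zero_mem _

theorem phi_comm (hq : q ≠ 0) (pl : Bool) {i j : ℕ} (h : cc M i j = 0) (m n : ℤ) :
    phiPA q M N false 2 i m * X q M N pl j n = X q M N pl j n * phiPA q M N false 2 i m ∧
    phiMA q M N false 2 i m * X q M N pl j n = X q M N pl j n * phiMA q M N false 2 i m := by
  have key := phi_mem q M N (Subalgebra.centralizer ℂ {X q M N pl j n}) i ?_ ?_ ?_ m
  · rw [Subalgebra.mem_centralizer_iff, Subalgebra.mem_centralizer_iff] at key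
    exact ⟨(key.1 _ rfl).symm, (key.2 _ rfl).symm⟩
  · rw [Subalgebra.mem_centralizer_iff]
    rintro _ rfl
    rw [KX, h]; simp
  · rw [Subalgebra.mem_centralizer_iff]
    rintro _ rfl
    rw [KiX q M N hq, h]; simp
  · intro s
    rw [Subalgebra.mem_centralizer_iff]
    rintro _ rfl
    obtain ⟨c, hc, h1⟩ := HX q M N pl i j s
    have := h1 n
    rw [hc h, zero_smul, sub_eq_zero] at this
    exact this.symm

theorem phi_QR (hq : q ≠ 0) (hq2 : q ^ 2 ≠ 1) (pl : Bool) {i j : ℕ} (hij : i ≠ j)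
    (h : cc M i j ≠ 0) :
    QR (q ^ (sg pl * cc M i j)) (phiPA q M N false 2 i) (X q M N pl j) ∧
    QR (q ^ (sg pl * cc M i j)) (phiMA q M N false 2 i) (X q M N pl j) := by
  obtain ⟨e, he, hpm⟩ := PM q M N hq hq2 pl i
  apply QRsep (zpow_ne_zero _ hq)
  · refine QRder he (XXQ q M N pl i j h) (fun n => PMne q M N pl hij.symm n 0) (s := sgn M i i) ?_
    intro n
    simpa using hpm n 0
  · intro m hm; simp [phiPA, phiPF, not_le.mpr hm]
  · intro m hm; simp [phiMA, phiMF, not_le.mpr hm]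
  · intro n
    have : phiPA q M N false 2 i 0 = KA q M N false 2 i := by simp [phiPA, phiPF, expC, KA]
    rw [this, KX]
  · intro n
    have : phiMA q M N false 2 i 0 = KiA q M N false 2 i := by simp [phiMA, phiMF, expC, KiA]
    rw [this, KiX q M N hq]


end concrete

section abstract2
variable {R : Type} [Ring R] [Algebra ℂ R]

theorem caseL {p e : ℂ} (hp : p ≠ 0) {a b c P Q : ℤ → R} {y : R} {s : ℤ}
    (hP : QR p P b) (hQ : QR p Q b) (hcb : QR p⁻¹ c b)
    (hPc : ∀ m k, P m * c k = c k * P m) (hQc : ∀ m k, Q m * c k = c k * Q m)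
    (hbb : ∀ n u, b n * b u + b u * b n = 0)
    (hP0 : ∀ m < 0, P m = 0) (hQ0 : ∀ m > 0, Q m = 0)
    (hby : ∀ n, b n * y = y * b n) (hcy : ∀ n, c n * y = y * c n)
    (hay : ∀ m, a m * y - y * a m = e • (P (m + s) - Q (m + s))) (m n k u : ℤ) :
    Sw p (a m) (c k) (b n) (b u) * y = y * Sw p (a m) (c k) (b n) (b u) := by
  rw [← sub_eq_zero, Sw_comm_left _ _ _ _ _ _ (hcy k) (hby n) (hby u), hay, Sw_lin,
    Svan hp hP hcb hPc hbb (Or.inl hP0), Svan hp hQ hcb hQc hbb (Or.inr hQ0)]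
  simp

theorem caseM {p e : ℂ} (hp : p ≠ 0) {a b c P Q : ℤ → R} {y : R} {s : ℤ}
    (hPa : QR p P a) (hQa : QR p Q a) (hPc : QR p⁻¹ P c) (hQc : QR p⁻¹ Q c)
    (hab : QR p a b) (hcb : QR p⁻¹ c b)
    (hPb : ∀ m k, P m * b k = b k * P m) (hQb : ∀ m k, Q m * b k = b k * Q m)
    (hac : ∀ m k, a m * c k = c k * a m)
    (hP0 : ∀ m < 0, P m = 0) (hQ0 : ∀ m > 0, Q m = 0)
    (hay : ∀ n, a n * y = y * a n) (hcy : ∀ n, c n * y = y * c n)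
    (hby : ∀ m, b m * y + y * b m = e • (P (m + s) - Q (m + s))) (m n k u : ℤ) :
    Sw p (a m) (c k) (b n) (b u) * y = y * Sw p (a m) (c k) (b n) (b u) := by
  rw [← sub_eq_zero, Sw_comm_mid _ _ _ _ _ _ (hcy k) (hay m), hby, hby, Fw_lin, Fw_lin,
    Fvan hp hPa hPc hab hcb hPb hac (Or.inl hP0), Fvan hp hQa hQc hab hcb hQb hac (Or.inr hQ0),
    Fvan hp hPa hPc hab hcb hPb hac (Or.inl hP0), Fvan hp hQa hQc hab hcb hQb hac (Or.inr hQ0)]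
  simp

end abstract2

section concrete2
variable (q : ℂ) (M N : ℕ)

theorem cc_vals (hM : 1 < M) : cc M (M - 1) M = -1 ∧ cc M (M + 1) M = 1 ∧
    cc M M M = 0 ∧ cc M (M - 1) (M + 1) = 0 := by
  obtain ⟨k, rfl⟩ : ∃ k, M = k + 1 := ⟨M - 1, by omega⟩
  refine ⟨?_, ?_, ?_, ?_⟩ <;> simp [cc, form4, innerE, lof] <;> (try split_ifs) <;> omega

theorem XBB (hM : 1 < M) (pl : Bool) (n u : ℤ) : X q M N pl M n * X q M N pl M u +
    X q M N pl M u * X q M N pl M n = 0 := by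
  rw [XX0 q M N pl M M (cc_vals M hM).2.2.1]
  rw [show sgn M M M = -1 by simp [sgn]]
  module

theorem XAC (hM : 1 < M) (pl : Bool) (m k : ℤ) : X q M N pl (M - 1) m * X q M N pl (M + 1) k =
    X q M N pl (M + 1) k * X q M N pl (M - 1) m := by
  rw [XX0 q M N pl _ _ (cc_vals M hM).2.2.2, sgn_ne M (by omega), one_smul]

theorem Osc_eq (hq : q ≠ 0) (hM : 1 < M) (pl : Bool) (m n k u : ℤ) :
    OscElt q M N false 2 pl m n k u = q⁻¹ • Sw q (X q M N pl (M - 1) m) (X q M N pl (M + 1) k)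
      (X q M N pl M n) (X q M N pl M u) := by
  rw [← osc_Sw hq _ _ _ _ (XAC q M N hM pl m k) (XBB q M N hM pl n u)]
  rfl

theorem Sw_eq (hq : q ≠ 0) (pl : Bool) : ∃ e : ℂ, ∀ a c b d : V q M N,
    Sw q a c b d = e • Sw (q ^ (-sg pl)) a c b d := by
  cases pl
  · exact ⟨1, fun a c b d => by simp [sg]⟩
  · exact ⟨q ^ 2, fun a c b d => by simpa [sg] using Sw_inv hq a c b d⟩

theorem Osc_comm (hq : q ≠ 0) (hq2 : q ^ 2 ≠ 1) (hM : 1 < M) (pl : Bool) (m n k u : ℤ)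
    (i : ℕ) (s : ℤ) :
    OscElt q M N false 2 pl m n k u * X q M N (!pl) i s =
      X q M N (!pl) i s * OscElt q M N false 2 pl m n k u := by
  obtain ⟨c1, c2, c3, c4⟩ := cc_vals M hM
  have hP0 : ∀ i, ∀ m < 0, phiPA q M N false 2 i m = 0 := by
    intro i m hm; simp [phiPA, phiPF, not_le.mpr hm]
  have hQ0 : ∀ i, ∀ m > 0, phiMA q M N false 2 i m = 0 := by
    intro i m hm; simp [phiMA, phiMF, not_le.mpr hm]
  have hp : q ^ (-sg pl) ≠ 0 := zpow_ne_zero _ hq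
  have hAB : QR (q ^ (-sg pl)) (X q M N pl (M - 1)) (X q M N pl M) := by
    have := XXQ q M N pl (M - 1) M (by rw [c1]; norm_num)
    rwa [c1, mul_neg, mul_one] at this
  have hCB : QR (q ^ (-sg pl))⁻¹ (X q M N pl (M + 1)) (X q M N pl M) := by
    have := XXQ q M N pl (M + 1) M (by rw [c2]; norm_num)
    rwa [c2, mul_one, ← neg_neg (sg pl), zpow_neg] at this
  rw [Osc_eq q M N hq hM]
  rw [smul_mul_assoc, mul_smul_comm]
  congr 1
  obtain ⟨e, he⟩ := Sw_eq q M N hq pl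
  obtain ⟨ε, -, hpm⟩ := PM q M N hq hq2 pl i
  rw [he, smul_mul_assoc, mul_smul_comm]
  congr 1
  by_cases h1 : i = M - 1
  · subst h1
    have hφ := phi_QR q M N hq hq2 pl (i := M - 1) (j := M) (by omega) (by rw [c1]; norm_num)
    rw [c1, mul_neg, mul_one] at hφ
    refine caseL hp (s := s) (e := ε) hφ.1 hφ.2 hCB
      (fun m k => (phi_comm q M N hq pl c4 m k).1) (fun m k => (phi_comm q M N hq pl c4 m k).2)
      (XBB q M N hM pl) (hP0 _) (hQ0 _) (fun n => PMne q M N pl (by omega) n s)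
      (fun n => PMne q M N pl (by omega) n s) ?_ m n k u
    intro m
    have := hpm m s
    rwa [show sgn M (M - 1) (M - 1) = 1 by unfold sgn; rw [if_neg]; omega, one_smul] at this
  by_cases h2 : i = M + 1
  · subst h2
    have hφ := phi_QR q M N hq hq2 pl (i := M + 1) (j := M) (by omega) (by rw [c2]; norm_num)
    rw [c2, mul_one, ← neg_neg (sg pl), zpow_neg] at hφ
    rw [Sw_swap _ _ _ _ (XAC q M N hM pl m k), Sw_inv hp, smul_mul_assoc, mul_smul_comm]
    congr 1
    rw [cc_comm] at c4
    refine caseL (inv_ne_zero hp) (s := s) (e := ε) hφ.1 hφ.2 (by rwa [inv_inv])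
      (fun m k => (phi_comm q M N hq pl c4 m k).1) (fun m k => (phi_comm q M N hq pl c4 m k).2)
      (XBB q M N hM pl) (hP0 _) (hQ0 _) (fun n => PMne q M N pl (by omega) n s)
      (fun n => PMne q M N pl (by omega) n s) ?_ k n m u
    intro m
    have := hpm m s
    rwa [show sgn M (M + 1) (M + 1) = 1 by unfold sgn; rw [if_neg]; omega, one_smul] at this
  by_cases h3 : i = M
  · subst h3
    have hφ := phi_QR q i N hq hq2 pl (i := i) (j := i - 1) (by omega)
      (by rw [cc_comm, c1]; norm_num)
    have hφ' := phi_QR q i N hq hq2 pl (i := i) (j := i + 1) (by omega)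
      (by rw [cc_comm, c2]; norm_num)
    rw [cc_comm, c1, mul_neg, mul_one] at hφ
    rw [cc_comm, c2, mul_one, ← neg_neg (sg pl), zpow_neg] at hφ'
    refine caseM hp (s := s) (e := ε) hφ.1 hφ.2 hφ'.1 hφ'.2 hAB hCB
      (fun m k => (phi_comm q i N hq pl c3 m k).1) (fun m k => (phi_comm q i N hq pl c3 m k).2)
      (XAC q i N hM pl) (hP0 _) (hQ0 _) (fun n => PMne q i N pl (by omega) n s)
      (fun n => PMne q i N pl (by omega) n s) ?_ m n k u
    intro m
    have := hpm m s
    rw [← this, show sgn i i i = -1 by simp [sgn]]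
    module
  · have hA := PMne q M N pl (Ne.symm h1) m s
    have hB := PMne q M N pl (Ne.symm h3) n s
    have hB' := PMne q M N pl (Ne.symm h3) u s
    have hC := PMne q M N pl (Ne.symm h2) k s
    rw [← sub_eq_zero, Sw_comm_left _ _ _ _ _ _ hC hB hB', hA]
    simp [Sw, Gw]

end concrete2
end OT

namespace OT
open QAS

section abstract3
variable {R : Type} [Ring R] [Algebra ℂ R]

theorem adjL (S : Set R) (Q : Submodule ℂ R)
    (h : ∀ s ∈ S, ∀ x ∈ Q, s * x ∈ Q * Subalgebra.toSubmodule (Algebra.adjoin ℂ S)) :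
    Subalgebra.toSubmodule (Algebra.adjoin ℂ S) * Q ≤
      Q * Subalgebra.toSubmodule (Algebra.adjoin ℂ S) := by
  rw [Submodule.mul_le]
  intro a ha
  rw [Subalgebra.mem_toSubmodule] at ha
  induction ha using Algebra.adjoin_induction with
  | mem s hs => exact h s hs
  | algebraMap r =>
    intro x hx
    rw [Algebra.commutes]
    exact Submodule.mul_mem_mul hx (Subalgebra.algebraMap_mem _ r)
  | add a b _ _ ha hb =>
    intro x hx
    rw [add_mul]
    exact add_mem (ha x hx) (hb x hx)
  | mul a b _ _ ha hb =>
    intro x hx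
    rw [mul_assoc]
    refine Submodule.mul_induction_on (hb x hx) ?_ ?_
    · intro y hy z hz
      rw [← mul_assoc]
      have := Submodule.mul_mem_mul (ha y hy) hz
      rwa [mul_assoc, (Subalgebra.isIdempotentElem_toSubmodule _).eq] at this
    · intro y z hy hz
      rw [mul_add]
      exact add_mem hy hz

theorem adjR (S : Set R) (Q : Submodule ℂ R)
    (h : ∀ s ∈ S, ∀ x ∈ Q, x * s ∈ Subalgebra.toSubmodule (Algebra.adjoin ℂ S) * Q) :
    Q * Subalgebra.toSubmodule (Algebra.adjoin ℂ S) ≤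
      Subalgebra.toSubmodule (Algebra.adjoin ℂ S) * Q := by
  rw [Submodule.mul_le]
  intro x hx a ha
  rw [Subalgebra.mem_toSubmodule] at ha
  induction ha using Algebra.adjoin_induction generalizing x with
  | mem s hs => exact h s hs x hx
  | algebraMap r =>
    rw [← Algebra.commutes]
    exact Submodule.mul_mem_mul (Subalgebra.algebraMap_mem _ r) hx
  | add a b _ _ ha hb =>
    rw [mul_add]
    exact add_mem (ha x hx) (hb x hx)
  | mul a b _ _ ha hb =>
    rw [← mul_assoc]
    refine Submodule.mul_induction_on (ha x hx) ?_ ?_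
    · intro y hy z hz
      rw [mul_assoc]
      have := Submodule.mul_mem_mul hy (hb z hz)
      rwa [← mul_assoc, (Subalgebra.isIdempotentElem_toSubmodule _).eq] at this
    · intro y z hy hz
      rw [add_mul]
      exact add_mem hy hz

theorem nice_swap (S Y : Set R)
    (h : ∀ g ∈ S, ∀ y ∈ Y, ∃ c : ℂ, c ≠ 0 ∧ g * y - c • (y * g) ∈ Submodule.span ℂ Y) :
    Submodule.span ℂ ({1} ∪ S) * Submodule.span ℂ Y ≤
      Submodule.span ℂ Y * Submodule.span ℂ ({1} ∪ S) ∧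
    Submodule.span ℂ Y * Submodule.span ℂ ({1} ∪ S) ≤
      Submodule.span ℂ ({1} ∪ S) * Submodule.span ℂ Y := by
  have one : (1 : R) ∈ Submodule.span ℂ ({1} ∪ S) := Submodule.subset_span (Or.inl rfl)
  constructor
  · rw [Submodule.span_mul_span, Submodule.span_le]
    rintro _ ⟨g, hg, y, hy, rfl⟩
    have hy' : y ∈ Submodule.span ℂ Y := Submodule.subset_span hy
    have hg' := Submodule.subset_span (R := ℂ) hg
    rcases hg with hg | hg
    · rw [Set.mem_singleton_iff] at hg
      subst hg
      have := Submodule.mul_mem_mul hy' one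
      simpa using this
    · obtain ⟨c, -, hc⟩ := h g hg y hy
      have h1 := Submodule.mul_mem_mul hc one
      have h2 := Submodule.smul_mem _ c (Submodule.mul_mem_mul hy' hg')
      have := add_mem h1 h2
      simpa using this
  · rw [Submodule.span_mul_span ℂ Y, Submodule.span_le]
    rintro _ ⟨y, hy, g, hg, rfl⟩
    have hy' : y ∈ Submodule.span ℂ Y := Submodule.subset_span hy
    have hg' := Submodule.subset_span (R := ℂ) hg
    rcases hg with hg | hg
    · rw [Set.mem_singleton_iff] at hg
      subst hg
      have := Submodule.mul_mem_mul one hy'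
      simpa using this
    · obtain ⟨c, hc0, hc⟩ := h g hg y hy
      have h1 := Submodule.mul_mem_mul one hc
      have h2 := Submodule.mul_mem_mul hg' hy'
      have := Submodule.smul_mem _ c⁻¹ (sub_mem h2 h1)
      have e : c⁻¹ • (g * y - 1 * (g * y - c • (y * g))) = y * g := by
        rw [one_mul, sub_sub_cancel, smul_smul, inv_mul_cancel₀ hc0, one_smul]
      rw [e] at this
      exact this

theorem Sw_K (p α β γ : ℂ) (a c b d k : R) (ha : k * a = α • (a * k)) (hc : k * c = γ • (c * k))
    (hb : k * b = β • (b * k)) (hd : k * d = β • (d * k)) :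
    k * Sw p a c b d = (α * β * β * γ) • (Sw p a c b d * k) := by
  have as : ∀ x : R, ∀ t : ℂ, k * x = t • (x * k) → ∀ z, k * (x * z) = t • (x * (k * z)) := by
    intro x t h z
    rw [← mul_assoc, h, smul_mul_assoc, mul_assoc]
  unfold Sw Gw
  simp only [mul_add, add_mul, mul_sub, sub_mul, smul_mul_assoc, mul_smul_comm, mul_assoc,
    as _ _ ha, as _ _ hb, as _ _ hc, as _ _ hd, ha, hb, hc, hd]
  module

theorem Sw_H (p : ℂ) (a c b d a' c' b' d' h : R) (ha : h * a - a * h = a')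
    (hc : h * c - c * h = c') (hb : h * b - b * h = b') (hd : h * d - d * h = d') :
    h * Sw p a c b d - Sw p a c b d * h =
      Sw p a' c b d + Sw p a c' b d + Sw p a c b' d + Sw p a c b d' := by
  subst ha hc hb hd
  unfold Sw Gw
  simp only [mul_add, add_mul, mul_sub, sub_mul, smul_mul_assoc, mul_smul_comm, mul_assoc]
  module

theorem Sw_smul (p t : ℂ) (a c b d : R) : Sw p (t • a) c b d = t • Sw p a c b d ∧
    Sw p a (t • c) b d = t • Sw p a c b d ∧ Sw p a c (t • b) d = t • Sw p a c b d ∧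
    Sw p a c b (t • d) = t • Sw p a c b d := by
  unfold Sw Gw
  refine ⟨?_, ?_, ?_, ?_⟩ <;> simp only [smul_mul_assoc, mul_smul_comm] <;> module

theorem scaleK (r c : ℂ) (k S : R) (h : k * S = c • (S * k)) :
    k * (r • S) - c • ((r • S) * k) = 0 := by
  rw [mul_smul_comm, smul_mul_assoc, h, smul_comm, sub_self]

theorem scaleH (r : ℂ) (k S T : R) (h : k * S - S * k = T) :
    k * (r • S) - (1 : ℂ) • ((r • S) * k) = r • T := by
  rw [one_smul, mul_smul_comm, smul_mul_assoc, ← smul_sub, h]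

theorem sup_mulR (S : Set R) (Q T : Submodule ℂ R) (y x : R) (h1 : ∀ x ∈ S, x * y ∈ T)
    (h2 : ∀ x ∈ Q, x * y ∈ T) (hx : x ∈ Submodule.span ℂ S ⊔ Q) : x * y ∈ T := by
  obtain ⟨u, hu, v, hv, rfl⟩ := Submodule.mem_sup.mp hx
  rw [add_mul]
  refine add_mem ?_ (h2 v hv)
  clear hx
  induction hu using Submodule.span_induction with
  | mem x hx => exact h1 x hx
  | zero => rw [zero_mul]; exact zero_mem _
  | add x z _ _ hx hz => rw [add_mul]; exact add_mem hx hz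
  | smul c x _ hx => rw [smul_mul_assoc]; exact Submodule.smul_mem _ _ hx

end abstract3

section concrete3
variable (q : ℂ) (M N : ℕ)

def gZ : Set (V q M N) := {x | (∃ i : ℕ, x = KA q M N false 2 i) ∨
  (∃ i : ℕ, x = KiA q M N false 2 i) ∨ ∃ i : ℕ, ∃ s : ℤ, x = HA q M N false 2 i s}

def gX (pl : Bool) : Set (V q M N) := {x | ∃ i : ℕ, ∃ n : ℤ, x = X q M N pl i n}

def ZZ : Submodule ℂ (V q M N) := Subalgebra.toSubmodule (Algebra.adjoin ℂ (gZ q M N))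

def PP (pl : Bool) : Submodule ℂ (V q M N) :=
  Subalgebra.toSubmodule (Algebra.adjoin ℂ (gX q M N pl))

def GG : Submodule ℂ (V q M N) := Submodule.span ℂ ({1} ∪ gZ q M N)

theorem GG_le : GG q M N ≤ ZZ q M N := by
  unfold GG ZZ
  rw [Submodule.span_le]
  rintro x (hx | hx)
  · rw [Set.mem_singleton_iff] at hx
    subst hx
    exact one_mem (Algebra.adjoin ℂ (gZ q M N))
  · exact Algebra.subset_adjoin hx

theorem gZ_GG {g : V q M N} (hg : g ∈ gZ q M N) : g ∈ GG q M N :=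
  Submodule.subset_span (Or.inr hg)

theorem PP_mul (pl : Bool) : PP q M N pl * PP q M N pl = PP q M N pl :=
  (Subalgebra.isIdempotentElem_toSubmodule _).eq
theorem ZZ_mul : ZZ q M N * ZZ q M N = ZZ q M N :=
  (Subalgebra.isIdempotentElem_toSubmodule _).eq

theorem X_mem (pl : Bool) (i : ℕ) (n : ℤ) : X q M N pl i n ∈ PP q M N pl :=
  Algebra.subset_adjoin ⟨i, n, rfl⟩

theorem nice_X (hq : q ≠ 0) (pl : Bool) : ∀ g ∈ gZ q M N, ∀ y ∈ gX q M N pl,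
    ∃ c : ℂ, c ≠ 0 ∧ g * y - c • (y * g) ∈ Submodule.span ℂ (gX q M N pl) := by
  rintro g hg _ ⟨j, n, rfl⟩
  rcases hg with ⟨i, rfl⟩ | ⟨i, rfl⟩ | ⟨i, s, rfl⟩
  · refine ⟨q ^ (sg pl * cc M i j), zpow_ne_zero _ hq, ?_⟩
    rw [KX, sub_self]
    exact zero_mem _
  · refine ⟨(q ^ (sg pl * cc M i j))⁻¹, inv_ne_zero (zpow_ne_zero _ hq), ?_⟩
    rw [KiX q M N hq, sub_self]
    exact zero_mem _
  · obtain ⟨c, -, hc⟩ := HX q M N pl i j s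
    refine ⟨1, one_ne_zero, ?_⟩
    rw [one_smul, hc]
    exact Submodule.smul_mem _ _ (Submodule.subset_span ⟨_, _, rfl⟩)

theorem nice_O (hq : q ≠ 0) (hM : 1 < M) (pl : Bool) : ∀ g ∈ gZ q M N,
    ∀ y ∈ (Set.range fun p : ℤ × ℤ × ℤ × ℤ => OscElt q M N false 2 pl p.1 p.2.1 p.2.2.1 p.2.2.2),
    ∃ c : ℂ, c ≠ 0 ∧ g * y - c • (y * g) ∈ Osub q M N false 2 pl := by
  rintro g hg _ ⟨⟨m, n, k, u⟩, rfl⟩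
  have hO : ∀ m n k u, OscElt q M N false 2 pl m n k u ∈ Osub q M N false 2 pl :=
    fun m n k u => Submodule.subset_span ⟨(m, n, k, u), rfl⟩
  have hS : ∀ m n k u, Sw q (X q M N pl (M - 1) m) (X q M N pl (M + 1) k)
      (X q M N pl M n) (X q M N pl M u) ∈ Osub q M N false 2 pl := by
    intro m n k u
    have := Submodule.smul_mem _ q (hO m n k u)
    rwa [Osc_eq q M N hq hM, smul_smul, mul_inv_cancel₀ hq, one_smul] at this
  simp only [Osc_eq q M N hq hM]
  rcases hg with ⟨i, rfl⟩ | ⟨i, rfl⟩ | ⟨i, s, rfl⟩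
  · refine ⟨q ^ (sg pl * cc M i (M - 1)) * q ^ (sg pl * cc M i M) * q ^ (sg pl * cc M i M) *
      q ^ (sg pl * cc M i (M + 1)), ?_, ?_⟩
    · have := fun k : ℤ => zpow_ne_zero k hq
      exact mul_ne_zero (mul_ne_zero (mul_ne_zero (this _) (this _)) (this _)) (this _)
    · rw [scaleK _ _ _ _ (Sw_K q _ _ _ _ _ _ _ _ (KX q M N pl i _ _)
        (KX q M N pl i _ _) (KX q M N pl i _ _) (KX q M N pl i _ _))]
      exact zero_mem _
  · refine ⟨(q ^ (sg pl * cc M i (M - 1)))⁻¹ * (q ^ (sg pl * cc M i M))⁻¹ *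
      (q ^ (sg pl * cc M i M))⁻¹ * (q ^ (sg pl * cc M i (M + 1)))⁻¹, ?_, ?_⟩
    · have := fun k : ℤ => inv_ne_zero (zpow_ne_zero k hq)
      exact mul_ne_zero (mul_ne_zero (mul_ne_zero (this _) (this _)) (this _)) (this _)
    · rw [scaleK _ _ _ _ (Sw_K q _ _ _ _ _ _ _ _ (KiX q M N hq pl i _ _)
        (KiX q M N hq pl i _ _) (KiX q M N hq pl i _ _) (KiX q M N hq pl i _ _))]
      exact zero_mem _
  · obtain ⟨ca, -, ha⟩ := HX q M N pl i (M - 1) s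
    obtain ⟨cb, -, hb⟩ := HX q M N pl i M s
    obtain ⟨c, -, hc⟩ := HX q M N pl i (M + 1) s
    refine ⟨1, one_ne_zero, ?_⟩
    rw [scaleH _ _ _ _ (Sw_H q _ _ _ _ _ _ _ _ _ (ha m) (hc k) (hb n) (hb u)), (Sw_smul _ _ _ _ _ _).1,
      (Sw_smul _ _ _ _ _ _).2.1, (Sw_smul _ _ _ _ _ _).2.2.1, (Sw_smul _ _ _ _ _ _).2.2.2]
    exact Submodule.smul_mem _ _ (add_mem (add_mem (add_mem (Submodule.smul_mem _ _ (hS _ _ _ _))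
      (Submodule.smul_mem _ _ (hS _ _ _ _))) (Submodule.smul_mem _ _ (hS _ _ _ _)))
      (Submodule.smul_mem _ _ (hS _ _ _ _)))

theorem spanX_le (pl : Bool) : Submodule.span ℂ (gX q M N pl) ≤ PP q M N pl :=
  Submodule.span_le.mpr Algebra.subset_adjoin

theorem ZP (hq : q ≠ 0) (pl : Bool) : ZZ q M N * PP q M N pl ≤ PP q M N pl * ZZ q M N := by
  have h1 : GG q M N * PP q M N pl ≤ PP q M N pl * GG q M N := by
    apply adjR
    intro s hs x hx
    have h2 : x * s ∈ GG q M N * Submodule.span ℂ (gX q M N pl) :=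
      Submodule.mul_mem_mul hx (Submodule.subset_span hs)
    exact mul_le_mul_left (spanX_le q M N pl) _
      ((nice_swap _ _ (nice_X q M N hq pl)).1 h2)
  apply adjL
  intro s hs x hx
  exact mul_le_mul_right (GG_le q M N) _ (h1 (Submodule.mul_mem_mul (gZ_GG q M N hs) hx))

theorem PZ (hq : q ≠ 0) (pl : Bool) : PP q M N pl * ZZ q M N ≤ ZZ q M N * PP q M N pl := by
  have h1 : PP q M N pl * GG q M N ≤ GG q M N * PP q M N pl := by
    apply adjL
    intro s hs x hx
    have h2 : s * x ∈ Submodule.span ℂ (gX q M N pl) * GG q M N :=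
      Submodule.mul_mem_mul (Submodule.subset_span hs) hx
    exact mul_le_mul_right (spanX_le q M N pl) _
      ((nice_swap _ _ (nice_X q M N hq pl)).2 h2)
  apply adjR
  intro s hs x hx
  exact mul_le_mul_left (GG_le q M N) _ (h1 (Submodule.mul_mem_mul hx (gZ_GG q M N hs)))

theorem ZO (hq : q ≠ 0) (hM : 1 < M) (pl : Bool) :
    ZZ q M N * Osub q M N false 2 pl ≤ Osub q M N false 2 pl * ZZ q M N := by
  apply adjL
  intro s hs x hx
  exact mul_le_mul_right (GG_le q M N) _
    ((nice_swap _ _ (nice_O q M N hq hM pl)).1 (Submodule.mul_mem_mul (gZ_GG q M N hs) hx))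

theorem OZ (hq : q ≠ 0) (hM : 1 < M) (pl : Bool) :
    Osub q M N false 2 pl * ZZ q M N ≤ ZZ q M N * Osub q M N false 2 pl := by
  apply adjR
  intro s hs x hx
  exact mul_le_mul_left (GG_le q M N) _
    ((nice_swap _ _ (nice_O q M N hq hM pl)).2 (Submodule.mul_mem_mul hx (gZ_GG q M N hs)))

theorem O_comm (hq : q ≠ 0) (hq2 : q ^ 2 ≠ 1) (hM : 1 < M) (pl : Bool) (i : ℕ) (s : ℤ)
    (x : V q M N) (hx : x ∈ Osub q M N false 2 pl) :
    x * X q M N (!pl) i s = X q M N (!pl) i s * x := by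
  induction hx using Submodule.span_induction with
  | mem x hx =>
    obtain ⟨⟨m, n, k, u⟩, rfl⟩ := hx
    exact Osc_comm q M N hq hq2 hM pl m n k u i s
  | zero => simp
  | add x y _ _ hx hy => rw [add_mul, mul_add, hx, hy]
  | smul c x _ hx => rw [smul_mul_assoc, mul_smul_comm, hx]

theorem OP (hq : q ≠ 0) (hq2 : q ^ 2 ≠ 1) (hM : 1 < M) (pl : Bool) :
    Osub q M N false 2 pl * PP q M N (!pl) ≤ PP q M N (!pl) * Osub q M N false 2 pl := by
  apply adjR
  rintro _ ⟨i, s, rfl⟩ x hx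
  rw [O_comm q M N hq hq2 hM pl i s x hx]
  exact Submodule.mul_mem_mul (X_mem q M N _ i s) hx

theorem PO (hq : q ≠ 0) (hq2 : q ^ 2 ≠ 1) (hM : 1 < M) (pl : Bool) :
    PP q M N (!pl) * Osub q M N false 2 pl ≤ Osub q M N false 2 pl * PP q M N (!pl) := by
  apply adjL
  rintro _ ⟨i, s, rfl⟩ x hx
  rw [← O_comm q M N hq hq2 hM pl i s x hx]
  exact Submodule.mul_mem_mul hx (X_mem q M N _ i s)

theorem one_le_PP (pl : Bool) : (1 : V q M N) ∈ PP q M N pl :=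
  one_mem (Algebra.adjoin ℂ (gX q M N pl))

theorem one_le_ZZ : (1 : V q M N) ∈ ZZ q M N := one_mem (Algebra.adjoin ℂ (gZ q M N))

theorem XPm (hq : q ≠ 0) (hq2 : q ^ 2 ≠ 1) :
    (Submodule.span ℂ (gX q M N true) ⊔ ZZ q M N) * PP q M N false ≤
      PP q M N false * (Submodule.span ℂ (gX q M N true) ⊔ ZZ q M N) := by
  apply adjR
  rintro _ ⟨j, n, rfl⟩ x hx
  change x * X q M N false j n ∈
    PP q M N false * (Submodule.span ℂ (gX q M N true) ⊔ ZZ q M N)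
  refine sup_mulR _ _ _ _ _ ?_ ?_ hx
  · rintro _ ⟨i, m, rfl⟩
    by_cases h : i = j
    · subst h
      obtain ⟨e, -, he⟩ := PM q M N hq hq2 true i
      have h1 := he m n
      rw [sub_eq_iff_eq_add] at h1
      change X q M N true i m * X q M N false i n = _ at h1
      rw [h1]
      have hK : KA q M N false 2 i ∈ Algebra.adjoin ℂ (gZ q M N) :=
        Algebra.subset_adjoin (Or.inl ⟨i, rfl⟩)
      have hKi : KiA q M N false 2 i ∈ Algebra.adjoin ℂ (gZ q M N) :=
        Algebra.subset_adjoin (Or.inr (Or.inl ⟨i, rfl⟩))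
      have hH : ∀ s, HA q M N false 2 i s ∈ Algebra.adjoin ℂ (gZ q M N) := fun s =>
        Algebra.subset_adjoin (Or.inr (Or.inr ⟨i, s, rfl⟩))
      have hφ := phi_mem q M N _ i hK hKi hH (m + n)
      refine add_mem (Submodule.smul_mem _ _ ?_) (Submodule.smul_mem _ _ ?_)
      · rw [← one_mul (_ - _)]
        exact Submodule.mul_mem_mul (one_le_PP q M N _)
          (Submodule.mem_sup_right (sub_mem hφ.1 hφ.2))
      · exact Submodule.mul_mem_mul (X_mem q M N false i n)
          (Submodule.mem_sup_left (Submodule.subset_span ⟨i, m, rfl⟩))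
    · have := PMne q M N true h m n
      change X q M N true i m * X q M N false j n = X q M N false j n * _ at this
      rw [this]
      exact Submodule.mul_mem_mul (X_mem q M N false j n)
          (Submodule.mem_sup_left (Submodule.subset_span ⟨i, m, rfl⟩))
  · intro z hz
    have hle : PP q M N false * ZZ q M N ≤
        PP q M N false * (Submodule.span ℂ (gX q M N true) ⊔ ZZ q M N) :=
      mul_le_mul' le_rfl le_sup_right
    exact hle (ZP q M N hq false (Submodule.mul_mem_mul hz (X_mem q M N false j n)))

theorem tri_top (hq : q ≠ 0) (hq2 : q ^ 2 ≠ 1) :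
    PP q M N false * ZZ q M N * PP q M N true = ⊤ := by
  set T := PP q M N false * ZZ q M N * PP q M N true with hT
  have hm : PP q M N false * T ≤ T := by
    rw [hT, ← mul_assoc, ← mul_assoc, PP_mul]
  have hz : ZZ q M N * T ≤ T := by
    calc ZZ q M N * T = (ZZ q M N * PP q M N false) * (ZZ q M N * PP q M N true) := by
          rw [hT]; simp only [mul_assoc]
      _ ≤ (PP q M N false * ZZ q M N) * (ZZ q M N * PP q M N true) := by
          exact mul_le_mul' (ZP q M N hq false) le_rfl
      _ = PP q M N false * (ZZ q M N * ZZ q M N) * PP q M N true := by simp only [mul_assoc]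
      _ = T := by rw [ZZ_mul]
  have hp : Submodule.span ℂ (gX q M N true) * T ≤ T := by
    have h1 : Submodule.span ℂ (gX q M N true) * (ZZ q M N * PP q M N true) ≤
        ZZ q M N * PP q M N true := by
      calc _ ≤ PP q M N true * (ZZ q M N * PP q M N true) := by
            exact mul_le_mul' (spanX_le q M N true) le_rfl
        _ = PP q M N true * ZZ q M N * PP q M N true := by rw [mul_assoc]
        _ ≤ ZZ q M N * PP q M N true * PP q M N true := by exact mul_le_mul' (PZ q M N hq true) le_rfl
        _ = _ := by rw [mul_assoc, PP_mul]
    calc Submodule.span ℂ (gX q M N true) * T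
        ≤ (Submodule.span ℂ (gX q M N true) ⊔ ZZ q M N) * T := by exact mul_le_mul' le_sup_left le_rfl
      _ = (Submodule.span ℂ (gX q M N true) ⊔ ZZ q M N) * PP q M N false *
            (ZZ q M N * PP q M N true) := by rw [hT]; simp only [mul_assoc]
      _ ≤ PP q M N false * (Submodule.span ℂ (gX q M N true) ⊔ ZZ q M N) *
            (ZZ q M N * PP q M N true) := by exact mul_le_mul' (XPm q M N hq hq2) le_rfl
      _ = PP q M N false * ((Submodule.span ℂ (gX q M N true) ⊔ ZZ q M N) *
            (ZZ q M N * PP q M N true)) := by rw [mul_assoc]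
      _ ≤ PP q M N false * (ZZ q M N * PP q M N true) := by
            refine mul_le_mul' le_rfl ?_
            rw [Submodule.sup_mul]
            refine sup_le h1 ?_
            rw [← mul_assoc, ZZ_mul]
      _ = T := by rw [hT, mul_assoc]
  have key : ∀ f : FA M N false, ∀ t ∈ T, mkA q M N false 2 f * t ∈ T := by
    intro f
    induction f using FreeAlgebra.induction with
    | grade0 r =>
      intro t ht
      rw [AlgHom.commutes, ← Algebra.smul_def]
      exact Submodule.smul_mem _ _ ht
    | add a b ha hb =>
      intro t ht
      rw [map_add, add_mul]
      exact add_mem (ha t ht) (hb t ht)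
    | mul a b ha hb =>
      intro t ht
      rw [map_mul, mul_assoc]
      exact ha _ (hb t ht)
    | grade1 g =>
      intro t ht
      have cz : ∀ g ∈ gZ q M N, g * t ∈ T := fun g hg =>
        hz (Submodule.mul_mem_mul (Algebra.subset_adjoin hg) ht)
      cases g with
      | Xp i n =>
        apply hp (Submodule.mul_mem_mul (Submodule.subset_span ⟨i.1, n, ?_⟩) ht)
        simp [X, XpA, XpF, gi, i.2.1, i.2.2]
      | Xm i n =>
        apply hm (Submodule.mul_mem_mul (Algebra.subset_adjoin ⟨i.1, n, ?_⟩) ht)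
        simp [X, XmA, XmF, gi, i.2.1, i.2.2]
      | K i =>
        refine cz _ (Or.inl ⟨i.1, ?_⟩)
        simp [KA, KF, gi, i.2.1, i.2.2]
      | Ki i =>
        refine cz _ (Or.inr (Or.inl ⟨i.1, ?_⟩))
        simp [KiA, KiF, gi, i.2.1, i.2.2]
      | H i s =>
        refine cz _ (Or.inr (Or.inr ⟨i.1, s.1, ?_⟩))
        simp [HA, HF, gi, i.2.1, i.2.2, s.2]
      | K0 h => exact absurd h (by simp)
      | K0i h => exact absurd h (by simp)
  rw [eq_top_iff]
  intro y _
  obtain ⟨f, rfl⟩ := RingQuot.mkAlgHom_surjective ℂ (rel q M N false 2) y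
  have h1 : (1 : V q M N) ∈ T := by
    have := Submodule.mul_mem_mul (Submodule.mul_mem_mul (one_le_PP q M N false)
      (one_le_ZZ q M N)) (one_le_PP q M N true)
    simpa using this
  have := key f 1 h1
  rwa [mul_one] at this

theorem Tplus_eq : Tplus7 q M N = PP q M N false * ZZ q M N * PP q M N true *
    Osub q M N false 2 true * PP q M N true := rfl

theorem Tminus_eq : Tminus7 q M N = PP q M N false * Osub q M N false 2 false *
    PP q M N false * ZZ q M N * PP q M N true := rfl

theorem plus_ideal (hq : q ≠ 0) (hq2 : q ^ 2 ≠ 1) (hM : 1 < M) :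
    ⊤ * Tplus7 q M N ≤ Tplus7 q M N ∧ Tplus7 q M N * ⊤ ≤ Tplus7 q M N := by
  have ht := tri_top q M N hq hq2
  rw [Tplus_eq, ht]
  set O := Osub q M N false 2 true
  constructor
  · rw [← mul_assoc, ← mul_assoc]
    exact mul_le_mul' (mul_le_mul' le_top le_rfl) le_rfl
  · calc ⊤ * O * PP q M N true * ⊤ ≤ ⊤ * O * ⊤ := by
          rw [mul_assoc (⊤ * O)]; exact mul_le_mul' le_rfl le_top
      _ = ⊤ * (O * PP q M N false) * ZZ q M N * PP q M N true := by
          have h3 : ⊤ * O * (PP q M N false * ZZ q M N * PP q M N true) =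
              ⊤ * (O * PP q M N false) * ZZ q M N * PP q M N true := by simp only [mul_assoc]
          rw [ht] at h3
          exact h3
      _ ≤ ⊤ * (PP q M N false * O) * ZZ q M N * PP q M N true := by
          exact mul_le_mul' (mul_le_mul' (mul_le_mul' le_rfl (OP q M N hq hq2 hM true)) le_rfl) le_rfl
      _ = (⊤ * PP q M N false) * (O * ZZ q M N) * PP q M N true := by simp only [mul_assoc]
      _ ≤ ⊤ * (ZZ q M N * O) * PP q M N true := by
          exact mul_le_mul' (mul_le_mul' le_top (OZ q M N hq hM true)) le_rfl
      _ = (⊤ * ZZ q M N) * O * PP q M N true := by simp only [mul_assoc]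
      _ ≤ _ := mul_le_mul' (mul_le_mul' le_top le_rfl) le_rfl

theorem minus_ideal (hq : q ≠ 0) (hq2 : q ^ 2 ≠ 1) (hM : 1 < M) :
    ⊤ * Tminus7 q M N ≤ Tminus7 q M N ∧ Tminus7 q M N * ⊤ ≤ Tminus7 q M N := by
  have ht := tri_top q M N hq hq2
  have e : Tminus7 q M N = PP q M N false * Osub q M N false 2 false * ⊤ := by
    rw [Tminus_eq, ← ht]; simp only [mul_assoc]
  rw [e]
  set O := Osub q M N false 2 false
  constructor
  · calc ⊤ * (PP q M N false * O * ⊤) = (⊤ * PP q M N false) * O * ⊤ := by simp only [mul_assoc]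
      _ ≤ ⊤ * O * ⊤ := mul_le_mul' (mul_le_mul' le_top le_rfl) le_rfl
      _ = (PP q M N false * ZZ q M N * PP q M N true) * O * ⊤ := by rw [ht]
      _ = PP q M N false * ZZ q M N * (PP q M N true * O) * ⊤ := by simp only [mul_assoc]
      _ ≤ PP q M N false * ZZ q M N * (O * PP q M N true) * ⊤ := by
          exact mul_le_mul' (mul_le_mul' le_rfl (PO q M N hq hq2 hM false)) le_rfl
      _ = PP q M N false * (ZZ q M N * O) * (PP q M N true * ⊤) := by simp only [mul_assoc]
      _ ≤ PP q M N false * (O * ZZ q M N) * ⊤ := by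
          exact mul_le_mul' (mul_le_mul' le_rfl (ZO q M N hq hM false)) le_top
      _ = PP q M N false * O * (ZZ q M N * ⊤) := by simp only [mul_assoc]
      _ ≤ _ := mul_le_mul' le_rfl le_top
  · rw [mul_assoc]
    exact mul_le_mul' le_rfl le_top

end concrete3
end OT
open QAS in
/-- in `V` (relations (R1)–(R5)), with `M, N > 1`, the graded commutator of
every element of `O^±` with every `X^∓_{i,0}` vanishes (the elements of `O^±` are even, so
this is the ordinary commutator); consequently `V⁻O⁻V⁻V⁰V⁺` and `V⁻V⁰V⁺O⁺V⁺` are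
two-sided ideals of `V`. -/
theorem Orels_triangular (q : ℂ) (hq0 : q ≠ 0)
    (hq1 : ∀ k : ℕ, k ≠ 0 → q ^ k ≠ 1) (M N : ℕ) (hM : 1 < M) (hN : 1 < N) :
    (∀ i : ℕ, 1 ≤ i → i ≤ M + N - 1 →
      (∀ x ∈ Osub q M N false 2 true,
        x * XmA q M N false 2 i 0 - XmA q M N false 2 i 0 * x = 0) ∧
      (∀ x ∈ Osub q M N false 2 false,
        x * XpA q M N false 2 i 0 - XpA q M N false 2 i 0 * x = 0)) ∧
    (∀ x ∈ Tplus7 q M N, ∀ y : ALG q M N false 2,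
      x * y ∈ Tplus7 q M N ∧ y * x ∈ Tplus7 q M N) ∧
    (∀ x ∈ Tminus7 q M N, ∀ y : ALG q M N false 2,
      x * y ∈ Tminus7 q M N ∧ y * x ∈ Tminus7 q M N) := by
  have hq2 : q ^ 2 ≠ 1 := hq1 2 (by norm_num)
  refine ⟨fun i _ _ => ⟨fun x hx => ?_, fun x hx => ?_⟩, fun x hx y => ⟨?_, ?_⟩,
    fun x hx y => ⟨?_, ?_⟩⟩
  · exact sub_eq_zero.mpr (OT.O_comm q M N hq0 hq2 hM true i 0 x hx)
  · exact sub_eq_zero.mpr (OT.O_comm q M N hq0 hq2 hM false i 0 x hx)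
  · exact (OT.plus_ideal q M N hq0 hq2 hM).2 (Submodule.mul_mem_mul hx Submodule.mem_top)
  · exact (OT.plus_ideal q M N hq0 hq2 hM).1 (Submodule.mul_mem_mul Submodule.mem_top hx)
  · exact (OT.minus_ideal q M N hq0 hq2 hM).2 (Submodule.mul_mem_mul hx Submodule.mem_top)
  · exact (OT.minus_ideal q M N hq0 hq2 hM).1 (Submodule.mul_mem_mul Submodule.mem_top hx)
end
end

section
/- For every 2 ≤ j ≤ M+N−1 and every n ∈ ℤ, one has [X_{α₁+⋯+α_{M+N−1}}(n), X⁺_{j,0}]_{λ_j} = 0 in U, where λ_j = q^{−(ε₁ − ε_{M+N}, ε_j − ε_{j+1})}, the bracket is the graded bracket [a,b]_u = ab − (−1)^{|a||b|} u ba, and X_{α₁+⋯+α_{M+N−1}}(n) is odd. -/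
noncomputable section

namespace QASProof

open QAS

section abstractLemmas
variable {A : Type} [Ring A] [Algebra ℂ A]

/-- the `q`-Serre expression. -/
def serreE (s : ℂ) (a b : A) : A := a * b * b - s • (b * a * b) + b * b * a

lemma serreE_br (s u : ℂ) (y a b : A) (hy : y * b = b * y) (h : serreE s a b = 0) :
    serreE s (brF u y a) b = 0 := by
  have e : serreE s (brF u y a) b = y * serreE s a b - u • (serreE s a b * y) := by
    have h1 : ∀ w, b * (y * w) = y * (b * w) := fun w => by rw [← mul_assoc, ← hy, mul_assoc]
    simp only [serreE, brF, mul_sub, sub_mul, mul_add, add_mul, smul_mul_assoc, mul_smul_comm,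
      smul_sub, smul_add, mul_assoc, h1, hy]
    module
  rw [e, h]; simp

/-- the anticommutator expression of the oscillation relation. -/
def oscE (u v : ℂ) (a b c : A) : A := brF v (brF u a b) c * b + b * brF v (brF u a b) c

lemma oscE_br (u v w : ℂ) (y a b c : A) (hb : y * b = b * y) (hc : y * c = c * y)
    (h : oscE u v a b c = 0) : oscE u v (brF w y a) b c = 0 := by
  have e : oscE u v (brF w y a) b c = y * oscE u v a b c - w • (oscE u v a b c * y) := by
    have h1 : ∀ w, b * (y * w) = y * (b * w) := fun w => by rw [← mul_assoc, ← hb, mul_assoc]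
    have h2 : ∀ w, c * (y * w) = y * (c * w) := fun w => by rw [← mul_assoc, ← hc, mul_assoc]
    simp only [oscE, brF, mul_sub, sub_mul, mul_add, add_mul, smul_mul_assoc, mul_smul_comm,
      smul_sub, smul_add, mul_assoc, h1, hb, h2, hc]
    module
  rw [e, h]; simp

lemma oscE_swap (u v : ℂ) (a b c : A) (hac : a * c = c * a) (hbb : b * b = 0) :
    oscE u v a b c = oscE v u a b c := by
  have h1 : ∀ w, b * (b * w) = 0 := fun w => by rw [← mul_assoc, hbb, zero_mul]
  have h2 : ∀ w, a * (c * w) = c * (a * w) := fun w => by rw [← mul_assoc, hac, mul_assoc]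
  simp only [oscE, brF, mul_sub, sub_mul, mul_add, add_mul, smul_mul_assoc, mul_smul_comm,
      smul_sub, smul_add, mul_assoc, h1, hbb, h2, hac, mul_zero]
  module

lemma middle (u s : ℂ) (hs : u * s = u ^ 2 + 1) (hs0 : s ≠ 0) (a b c : A) (hac : a * c = c * a)
    (ha : serreE s a b = 0) (hc : serreE s c b = 0) :
    brF u (brF u a b) c * b = b * brF u (brF u a b) c := by
  have h2 : ∀ w, a * (c * w) = c * (a * w) := fun w => by rw [← mul_assoc, hac, mul_assoc]
  have key : s • (brF u (brF u a b) c * b - b * brF u (brF u a b) c)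
      = - (a * serreE s c b) - (u ^ 2) • (c * serreE s a b)
        + serreE s a b * c + (u ^ 2) • (serreE s c b * a) := by
    simp only [serreE, brF, mul_sub, sub_mul, mul_add, add_mul, smul_mul_assoc, mul_smul_comm,
      smul_sub, smul_add, mul_assoc, h2, hac, smul_smul]
    have e : s * u = u ^ 2 + 1 := by rw [mul_comm, hs]
    simp only [e]
    module
  rw [ha, hc] at key
  simp only [mul_zero, zero_mul, smul_zero, sub_zero, add_zero, neg_zero] at key
  exact sub_eq_zero.mp ((smul_eq_zero.mp key).resolve_left hs0)

lemma end_even (u v : ℂ) (huv : v * u = 1) (a b : A) (h : serreE (u + v) a b = 0) :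
    brF u a b * b - v • (b * brF u a b) = 0 := by
  rw [← h]
  simp only [serreE, brF, mul_sub, sub_mul, smul_mul_assoc, mul_smul_comm,
      smul_sub, mul_assoc, smul_smul, huv]
  module

lemma end_odd (u : ℂ) (a b : A) (h : b * b = 0) :
    brF u a b * b - (-u) • (b * brF u a b) = 0 := by
  have h1 : ∀ w, b * (b * w) = 0 := fun w => by rw [← mul_assoc, h, zero_mul]
  simp only [brF, mul_sub, sub_mul, smul_mul_assoc, mul_smul_comm,
      smul_sub, mul_assoc, smul_smul, h, h1, mul_zero]
  module

lemma propagate (u t : ℂ) (y x b : A) (hx : x * b = b * x) (h : y * b = t • (b * y)) :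
    brF u y x * b = t • (b * brF u y x) := by
  have h1 : ∀ w, y * (b * w) = t • (b * (y * w)) := fun w => by
    rw [← mul_assoc, h, smul_mul_assoc, mul_assoc]
  have h2 : ∀ w, x * (b * w) = b * (x * w) := fun w => by rw [← mul_assoc, hx, mul_assoc]
  simp only [brF, mul_sub, sub_mul, smul_mul_assoc, mul_smul_comm,
      smul_sub, mul_assoc, smul_smul, hx, h, h1, h2]
  module

lemma sq_zero (x : A) (h : x * x - (-1 : ℂ) • (x * x) = 0) : x * x = 0 := by
  rw [neg_smul, one_smul, sub_neg_eq_add, ← two_smul ℂ] at h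
  exact (smul_eq_zero.mp h).resolve_left two_ne_zero

lemma anti (x y : A) (h : x * y + y * x = 0) : x * y = (-1 : ℂ) • (y * x) := by
  rw [neg_smul, one_smul]
  exact eq_neg_of_add_eq_zero_left h

end abstractLemmas

section relations
variable (q : ℂ) (M N : ℕ)

lemma XpA_eq {i : ℕ} (h : 1 ≤ i ∧ i ≤ M + N - 1) (n : ℤ) :
    XpA q M N false 3 i n = mkA q M N false 3 (gi (Gen.Xp ⟨i, h⟩ n)) := by
  simp only [XpA, XpF, dif_pos h]

lemma of_rel {x y : FA M N false} (h : rel q M N false 3 x y) :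
    mkA q M N false 3 x = mkA q M N false 3 y := RingQuot.mkAlgHom_rel ℂ h

lemma cc_far {i j : ℕ} (h : i + 2 ≤ j) : cc M i j = 0 := by
  simp only [cc, form4, innerE]
  rw [if_neg (by omega), if_neg (by omega), if_neg (by omega), if_neg (by omega)]; simp

lemma X_far {i j : ℕ} (hi : 1 ≤ i) (h : i + 2 ≤ j) (hj : j ≤ M + N - 1) (m n : ℤ) :
    XpA q M N false 3 i m * XpA q M N false 3 j n
      = XpA q M N false 3 j n * XpA q M N false 3 i m := by
  have hi' : 1 ≤ i ∧ i ≤ M + N - 1 := by omega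
  have hj' : 1 ≤ j ∧ j ≤ M + N - 1 := by omega
  have := of_rel q M N (rel.XX0p ⟨i, hi'⟩ ⟨j, hj'⟩ m n (by norm_num) (cc_far M h))
  have hs : sgn M i j = 1 := by simp only [sgn]; rw [if_neg (by omega)]
  simp only [hs, one_smul, map_sub, map_mul, map_zero] at this
  rw [XpA_eq q M N hi', XpA_eq q M N hj']
  exact sub_eq_zero.mp this

lemma X_sq (hM : 1 ≤ M) (hN : 1 ≤ N) (n : ℤ) :
    XpA q M N false 3 M n * XpA q M N false 3 M n = 0 := by
  have hi : 1 ≤ M ∧ M ≤ M + N - 1 := by omega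
  have hcc : cc M M M = 0 := by simp [cc, form4, innerE, lof]
  have := of_rel q M N (rel.XX0p ⟨M, hi⟩ ⟨M, hi⟩ n n (by norm_num) hcc)
  have hs : sgn M M M = -1 := by simp [sgn]
  simp only [hs, map_sub, map_mul, map_zero, map_smul] at this
  rw [XpA_eq q M N hi]
  exact sq_zero _ this

lemma X_serre (hq0 : q ≠ 0) {i j : ℕ} (hi : 1 ≤ i ∧ i ≤ M + N - 1) (hj : 1 ≤ j ∧ j ≤ M + N - 1)
    (hiM : i ≠ M) (hij : j = i + 1 ∨ i = j + 1) (m n : ℤ) :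
    serreE (q + q⁻¹) (XpA q M N false 3 j n) (XpA q M N false 3 i m) = 0 := by
  have hcc : cc M i j = 1 ∨ cc M i j = -1 := by
    rcases hij with rfl | rfl <;> simp [cc, form4, innerE, lof] <;> split_ifs <;> simp <;> omega
  have := of_rel q M N (rel.serreP ⟨i, hi⟩ ⟨j, hj⟩ m m n (by norm_num) hcc hiM)
  rw [XpA_eq q M N hi, XpA_eq q M N hj]
  rw [map_zero, ← two_smul ℂ, map_smul] at this
  have := (smul_eq_zero.mp this).resolve_left two_ne_zero
  rw [← this]
  simp only [brF, serreE, map_sub, map_mul, map_smul, mul_sub, sub_mul, smul_mul_assoc,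
    mul_smul_comm, smul_sub, mul_assoc, smul_smul, mul_inv_cancel₀ hq0]
  module

lemma X_osc (hM : 1 < M) (hN : 1 < N) (m n k : ℤ) :
    oscE q⁻¹ q (XpA q M N false 3 (M - 1) m) (XpA q M N false 3 M n)
      (XpA q M N false 3 (M + 1) k) = 0 := by
  have := of_rel q M N (rel.oscP m n k n (by norm_num) hM hN)
  rw [map_zero, ← two_smul ℂ, map_smul] at this
  have := (smul_eq_zero.mp this).resolve_left two_ne_zero
  rw [← this]
  simp only [oscE, oscOf, brF, XpA, map_add, map_sub, map_mul, map_smul]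

lemma Y_far (n : ℤ) (m : ℕ) (hm : m ≤ M + N - 1) : ∀ k : ℕ, k + 3 ≤ m →
    Xroot q M N false 3 1 k n * XpA q M N false 3 m 0
      = XpA q M N false 3 m 0 * Xroot q M N false 3 1 k n := by
  intro k
  induction k with
  | zero => intro hk; exact X_far q M N le_rfl (by omega) hm n 0
  | succ k ih =>
    intro hk
    have := propagate (qpar q M (1 + k + 1)) 1 (Xroot q M N false 3 1 k n) _ _
      (X_far q M N (by omega : 1 ≤ 1 + k + 1) (by omega) hm 0 0)
      (by rw [one_smul]; exact ih (by omega))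
    rw [one_smul] at this
    exact this

lemma Y_serre (hq0 : q ≠ 0) (n : ℤ) (k : ℕ) (hk : k + 2 ≤ M + N - 1) (hkM : k + 2 ≠ M) :
    serreE (q + q⁻¹) (Xroot q M N false 3 1 k n) (XpA q M N false 3 (k + 2) 0) = 0 := by
  cases k with
  | zero => exact X_serre q M N hq0 (by omega) (by omega) hkM (by omega) 0 n
  | succ k =>
    exact serreE_br _ _ _ _ _ (Y_far q M N n _ hk k (by omega))
      (X_serre q M N hq0 (by omega) (by omega) hkM (by omega) 0 0)

lemma Y_osc (n : ℤ) (k : ℕ) (hkM : k + 2 = M) (hN : 1 < N) :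
    oscE q q⁻¹ (Xroot q M N false 3 1 k n) (XpA q M N false 3 (k + 2) 0)
      (XpA q M N false 3 (k + 3) 0) = 0 := by
  have base : ∀ m : ℤ, oscE q q⁻¹ (XpA q M N false 3 (k + 1) m) (XpA q M N false 3 (k + 2) 0)
      (XpA q M N false 3 (k + 3) 0) = 0 := by
    intro m
    have h := X_osc q M N (by omega) hN m 0 0
    have h2 := X_sq q M N (by omega) (by omega) 0
    have e1 : M - 1 = k + 1 := by omega
    have e3 : M + 1 = k + 3 := by omega
    rw [e1, e3] at h
    rw [hkM]
    rw [oscE_swap _ _ _ _ _ (X_far q M N (by omega) (by omega) (by omega) _ _) h2]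
    exact h
  cases k with
  | zero => exact base n
  | succ k =>
    have h := base 0
    rw [show k + 1 + 1 = 1 + k + 1 by omega] at h
    exact oscE_br _ _ _ _ _ _ _ (Y_far q M N n _ (by omega) k (by omega))
      (Y_far q M N n _ (by omega) k (by omega)) h

lemma Y_mid (hq0 : q ≠ 0) (hs0 : q + q⁻¹ ≠ 0) (n : ℤ) (k : ℕ) (hk : k + 3 ≤ M + N - 1) :
    Xroot q M N false 3 1 (k + 2) n * XpA q M N false 3 (k + 2) 0
      = (if k + 2 = M then (-1 : ℂ) else 1) •
        (XpA q M N false 3 (k + 2) 0 * Xroot q M N false 3 1 (k + 2) n) := by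
  have e : Xroot q M N false 3 1 (k + 2) n
      = brF (qpar q M (k + 3)) (brF (qpar q M (k + 2)) (Xroot q M N false 3 1 k n)
        (XpA q M N false 3 (k + 2) 0)) (XpA q M N false 3 (k + 3) 0) := by
    simp only [Xroot]
    rw [show 1 + (k + 1) + 1 = k + 3 by omega, show 1 + k + 1 = k + 2 by omega]
  rw [e]
  split_ifs with h
  · have h1 : qpar q M (k + 3) = q⁻¹ := by
      simp only [qpar, lof]; rw [if_neg (by omega)]; simp
    have h2 : qpar q M (k + 2) = q := by
      simp only [qpar, lof]; rw [if_pos (by omega)]; simp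
    rw [h1, h2]
    exact anti _ _ (Y_osc q M N n k h (by omega))
  · have h1 : qpar q M (k + 3) = qpar q M (k + 2) := by
      simp only [qpar, lof]; congr 1; split_ifs <;> omega
    rw [h1, one_smul]
    refine middle _ (q + q⁻¹) ?_ hs0 _ _ _ (Y_far q M N n _ hk k (by omega))
      (Y_serre q M N hq0 n k (by omega) h) 
      (X_serre q M N hq0 (by omega) (by omega) h (by omega) 0 0)
    simp only [qpar, lof]
    split_ifs
    · simp; field_simp
    · simp; field_simp; ring

lemma Y_after (hq0 : q ≠ 0) (hs0 : q + q⁻¹ ≠ 0) (n : ℤ) (k : ℕ) (d : ℕ) (hk : k + 3 + d ≤ M + N - 1) :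
    Xroot q M N false 3 1 (k + 2 + d) n * XpA q M N false 3 (k + 2) 0
      = (if k + 2 = M then (-1 : ℂ) else 1) •
        (XpA q M N false 3 (k + 2) 0 * Xroot q M N false 3 1 (k + 2 + d) n) := by
  induction d with
  | zero => exact Y_mid q M N hq0 hs0 n k hk
  | succ d ih =>
    have hx := (X_far q M N (by omega : 1 ≤ k + 2) (by omega : k + 2 + 2 ≤ 1 + (k + 2 + d) + 1)
      (by omega) 0 0).symm
    exact propagate _ _ _ _ _ hx (ih (by omega))

end relations

end QASProof

open QAS in
/-- Lemma 3.10: for `2 ≤ j ≤ M+N−1` and `n ∈ ℤ`,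
`[X_{α₁+⋯+α_{M+N−1}}(n), X⁺_{j,0}]_{λ_j} = 0` in `U`, where
`λ_j = q^{−(ε₁−ε_{M+N}, ε_j−ε_{j+1})}` and the bracket carries the super sign
`(−1)^{p(β)p(α_j)}` (`= −1` exactly when `j = M`, the full root vector being odd). -/
theorem rootvec_commutation (q : ℂ) (hq0 : q ≠ 0)
    (hq1 : ∀ k : ℕ, k ≠ 0 → q ^ k ≠ 1) (M N : ℕ) (hM : 1 ≤ M) (hN : 1 ≤ N) :
    ∀ j : ℕ, 2 ≤ j → j ≤ M + N - 1 → ∀ n : ℤ,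
      XrootIJ q M N false 3 1 (M + N - 1) n * XpA q M N false 3 j 0 -
        ((if j = M then (-1 : ℂ) else 1) * q ^ (-(form4 M 1 (M + N) j (j + 1)))) •
          (XpA q M N false 3 j 0 * XrootIJ q M N false 3 1 (M + N - 1) n) = 0 := by
  intro j hj2 hjL n
  have hs0 : q + q⁻¹ ≠ 0 := by
    intro h
    have h2 : q ^ 2 = -1 := by
      field_simp at h
      linear_combination h
    exact hq1 4 (by norm_num) (by linear_combination (q ^ 2 - 1) * h2)
  obtain ⟨k, rfl⟩ : ∃ k, j = k + 2 := ⟨j - 2, by omega⟩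
  rcases Nat.lt_or_ge (k + 2) (M + N - 1) with h | h
  · obtain ⟨d, hd⟩ : ∃ d, M + N - 1 - 1 = k + 2 + d := ⟨M + N - 1 - 1 - (k + 2), by omega⟩
    have hf : form4 M 1 (M + N) (k + 2) (k + 2 + 1) = 0 := by
      simp only [form4, innerE]
      rw [if_neg (by omega), if_neg (by omega), if_neg (by omega), if_neg (by omega)]; simp
    rw [hf, XrootIJ, hd, sub_eq_zero]
    simpa using QASProof.Y_after q M N hq0 hs0 n k d (by omega)
  · have hd : M + N - 1 - 1 = k + 1 := by omega
    have hf : form4 M 1 (M + N) (k + 2) (k + 2 + 1) = -1 := by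
      simp only [form4, innerE, lof]
      rw [if_neg (by omega), if_neg (by omega), if_neg (by omega), if_pos (by omega),
        if_neg (by omega)]; simp
    have e : Xroot q M N false 3 1 (k + 1) n = brF (qpar q M (k + 2))
        (Xroot q M N false 3 1 k n) (XpA q M N false 3 (k + 2) 0) := by
      simp only [Xroot]
      rw [show 1 + k + 1 = k + 2 by omega]
    rw [hf, XrootIJ, hd, e, neg_neg, zpow_one]
    split_ifs with hM'
    · have h2 : qpar q M (k + 2) = q := by
        simp only [qpar, lof]; rw [if_pos (by omega)]; simp
      rw [h2, neg_one_mul]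
      have hsq := QASProof.X_sq q M N hM hN 0
      rw [← hM'] at hsq ⊢
      exact QASProof.end_odd q _ _ hsq
    · have h2 : qpar q M (k + 2) = q⁻¹ := by
        simp only [qpar, lof]; rw [if_neg (by omega)]; simp
      rw [h2, one_mul]
      refine QASProof.end_even q⁻¹ q (mul_inv_cancel₀ hq0) _ _ ?_
      rw [add_comm]
      exact QASProof.Y_serre q M N hq0 n k (by omega) hM'
end
end
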